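/- Let N_n be uniformly distributed on {1, 2, …, n}, and let Ω(k) denote the number of prime divisors of k counted with multiplicity. Let Φ₂(w) := (1/Γ(1+w))·∏_{q prime} (1 − w/(q−1))^{−1}(1 − 1/q)^w, which is analytic in a neighbourhood of w = 0, and let ã_{l} denote its Taylor coefficients at 0 (so ã_0 = 1). Fix r ≥ 1 and put λ_n := log log n and ν_r^{(2)}{j} := Po(λ_n){j}·(1 + Σ_{l=1}^r (−1)^l ã_{l} C_l(j;λ_n)). Then there exist constants C_{r} and C̃ such that for all n ≥ 16: sup_{j} |P(Ω(N_n) = j) − ν_r^{(2)}{j}| ≤ C_{r}(log log n)^{−1−r/2} + ã_1 C̃ / log n, and sup_{l} |P(Ω(N_n) ≤ l) − ν_r^{(2)}{[0,l]}| ≤ C_{r}(log log n)^{−(r+1)/2} + C̃ · (log log n)/log n. -/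

import Mathlib

open Real

noncomputable section

/-- The Poisson point probabilities `Po(λ){j}` for `j : ℤ` (zero for `j < 0`). -/
def poissonPmf (lam : ℝ) (j : ℤ) : ℝ :=
  if 0 ≤ j then Real.exp (-lam) * lam ^ j.toNat / (Nat.factorial j.toNat) else 0

/-- The `l`-th Charlier polynomial `C_l(j;λ)`. -/
def charlier (l : ℕ) (lam : ℝ) (j : ℕ) : ℝ :=
  ∑ k ∈ Finset.range (l + 1),
    (-1 : ℝ) ^ k * (Nat.choose l k) * (Nat.choose j k) * (Nat.factorial k) * lam ^ (-(k : ℤ))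

/-- The Poisson–Charlier signed measure `ν_r(λ; ã₁,…,ã_r)` on `ℤ` (supported on `ℕ`). -/
def pcMeasure (lam : ℝ) (r : ℕ) (ta : ℕ → ℝ) (j : ℤ) : ℝ :=
  poissonPmf lam j *
    (1 + ∑ l ∈ Finset.Icc 1 r, (-1 : ℝ) ^ l * ta l * charlier l lam j.toNat)

/-- The `l`-th Taylor coefficient at `0` of a function `ℂ → ℂ`. -/
def taylorCoeff (f : ℂ → ℂ) (l : ℕ) : ℂ := iteratedDeriv l f 0 / (Nat.factorial l)

/-- `Ω(k)`, the number of prime divisors of `k` counted with multiplicity. -/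
def bigOmega (k : ℕ) : ℕ := k.primeFactorsList.length

/-- The arithmetic factor `Φ₂(w) = Γ(1+w)⁻¹ ∏_q (1-w/(q-1))⁻¹(1-1/q)^w` appearing in
the Rényi–Turán / Selberg formula for the characteristic function of `Ω(N_n)`. -/
def Phi2 (w : ℂ) : ℂ :=
  (1 / Complex.Gamma (1 + w)) *
    ∏' q : Nat.Primes, ((1 - w / (((q : ℕ) : ℂ) - 1))⁻¹ * (1 - 1 / ((q : ℕ) : ℂ)) ^ w)

open MeasureTheory FourierTransform SchwartzMap in
lemma plancherel_L1L2 {g : ℝ → ℂ} (hg1 : Integrable g) (hg2 : MemLp g 2)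
    (hF : MemLp (𝓕 g) 2) : ∫ t, ‖g t‖ ^ 2 = ∫ ξ, ‖𝓕 g ξ‖ ^ 2 := by
  have key : 𝓕 (hg2.toLp g) = hF.toLp (𝓕 g) := by
    have hd : DenseRange (toLpCLM ℂ (E := ℝ) ℂ 2 volume) :=
      denseRange_toLpCLM (p := 2) ENNReal.ofNat_ne_top
    refine hd.eq_of_inner_left (𝕜 := ℂ) ?_
    rintro φ
    have h1 : toLpCLM ℂ (E := ℝ) ℂ 2 volume φ = 𝓕 ((𝓕⁻ φ).toLp 2) := by
      rw [SchwartzMap.toLp_fourier_eq]; simp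
    have h2 : inner ℂ (toLpCLM ℂ (E := ℝ) ℂ 2 volume φ) (𝓕 (hg2.toLp g))
        = inner ℂ ((𝓕⁻ φ).toLp 2) (hg2.toLp g) := by
      rw [h1, Lp.inner_fourier_eq]
    rw [← inner_conj_symm, h2, ← inner_conj_symm (𝕜 := ℂ) (hF.toLp (𝓕 g))]
    congr 1
    rw [L2.inner_def, L2.inner_def]
    have e1 : ∫ a, inner ℂ ((((𝓕⁻ φ).toLp 2 : Lp ℂ 2 (volume : Measure ℝ)) : ℝ → ℂ) a) (hg2.toLp g a) = ∫ a, inner ℂ ((𝓕⁻ φ) a) (g a) := by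
      apply integral_congr_ae
      filter_upwards [(𝓕⁻ φ).coeFn_toLp 2 (volume : Measure ℝ), hg2.coeFn_toLp] with a h1 h2
      rw [h1, h2]
    have e2 : ∫ a, inner ℂ (toLpCLM ℂ (E := ℝ) ℂ 2 volume φ a) (hF.toLp (𝓕 g) a)
        = ∫ a, inner ℂ (φ a) (𝓕 g a) := by
      apply integral_congr_ae
      filter_upwards [φ.coeFn_toLp 2 (volume : Measure ℝ), hF.coeFn_toLp] with a h1 h2
      rw [toLpCLM_apply, h1, h2]
    rw [e1, e2]
    have := VectorFourier.integral_sesq_fourierIntegral_eq_neg_flip (innerSL ℂ)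
      (L := innerₗ ℝ) continuous_fourierChar continuous_inner hg1 (φ.integrable (μ := volume))
    have h3 : ∫ ξ, inner ℂ (𝓕 g ξ) (φ ξ) = ∫ x, inner ℂ (g x) ((𝓕⁻ φ) x) := by
      simpa [fourierInv_coe] using! this
    calc ∫ a, inner ℂ ((𝓕⁻ φ) a) (g a) = ∫ a, (starRingEnd ℂ) (inner ℂ (g a) ((𝓕⁻ φ) a)) := by
          simp_rw [inner_conj_symm]
      _ = (starRingEnd ℂ) (∫ a, (inner ℂ (g a) ((𝓕⁻ φ) a))) := integral_conj
      _ = (starRingEnd ℂ) (∫ ξ, inner ℂ (𝓕 g ξ) (φ ξ)) := by rw [h3]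
      _ = ∫ ξ, (starRingEnd ℂ) (inner ℂ (𝓕 g ξ) (φ ξ)) := integral_conj.symm
      _ = _ := by simp_rw [inner_conj_symm]
  have hn : ∀ {h : ℝ → ℂ} (hh : MemLp h 2), ∫ t, ‖h t‖ ^ 2 = ‖hh.toLp h‖ ^ 2 := by
    intro h hh
    have := L2.inner_def (𝕜 := ℂ) (hh.toLp h) (hh.toLp h)
    rw [inner_self_eq_norm_sq_to_K] at this
    have e : ∫ a, inner ℂ (hh.toLp h a) (hh.toLp h a) = ∫ a, ((‖h a‖ ^ 2 : ℝ) : ℂ) := by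
      apply integral_congr_ae
      filter_upwards [hh.coeFn_toLp] with a h1
      rw [h1, inner_self_eq_norm_sq_to_K]; simp
    rw [e, integral_complex_ofReal] at this
    apply Complex.ofReal_injective
    rw [← this]; simp
  rw [hn hg2, hn hF, ← key, Lp.norm_fourier_eq]

lemma bigOmega_eq (k : ℕ) : bigOmega k = ArithmeticFunction.cardFactors k := by
  rw [bigOmega, ArithmeticFunction.cardFactors_apply]

/-- completely multiplicative summand `z^Ω(n) n^{-s}` -/
def omHom (z s : ℂ) : ℕ →*₀ ℂ where
  toFun n := if n = 0 then 0 else z ^ bigOmega n * (n : ℂ) ^ (-s)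
  map_zero' := by simp
  map_one' := by simp [bigOmega]
  map_mul' m n := by
    by_cases hm : m = 0
    · simp [hm]
    by_cases hn : n = 0
    · simp [hn]
    simp only [hm, hn, mul_eq_zero, or_self, if_false]
    rw [bigOmega_eq, ArithmeticFunction.cardFactors_mul hm hn, pow_add, bigOmega_eq, bigOmega_eq,
      Nat.cast_mul, Complex.natCast_mul_natCast_cpow m n (-s)]
    ring

/-- the Dirichlet series of `z^Ω(n)` -/
def FL (z s : ℂ) : ℂ := LSeries (fun n => z ^ bigOmega n) s

lemma norm_zpow_le {z : ℂ} (hz : ‖z‖ ≤ 1) (n : ℕ) : ‖z ^ bigOmega n‖ ≤ 1 := by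
  rw [norm_pow]; exact pow_le_one₀ (norm_nonneg _) hz

lemma FL_absc {z : ℂ} (hz : ‖z‖ ≤ 1) :
    LSeries.abscissaOfAbsConv (fun n => z ^ bigOmega n) ≤ 1 :=
  LSeries.abscissaOfAbsConv_le_of_le_const ⟨1, fun n _ => norm_zpow_le hz n⟩

lemma FL_absc_lt {z s : ℂ} (hz : ‖z‖ ≤ 1) (hs : 1 < s.re) :
    LSeries.abscissaOfAbsConv (fun n => z ^ bigOmega n) < s.re :=
  (FL_absc hz).trans_lt (by exact_mod_cast hs)

lemma FL_summable {z s : ℂ} (hz : ‖z‖ ≤ 1) (hs : 1 < s.re) :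
    LSeriesSummable (fun n => z ^ bigOmega n) s :=
  LSeriesSummable_of_bounded_of_one_lt_re (m := 1) (fun n _ => norm_zpow_le hz n) hs

lemma omHom_eq_term (z s : ℂ) (n : ℕ) :
    omHom z s n = LSeries.term (fun n => z ^ bigOmega n) s n := by
  rw [LSeries.term_def]
  simp only [omHom, MonoidWithZeroHom.coe_mk, ZeroHom.coe_mk]
  split_ifs with h
  · rfl
  · rw [Complex.cpow_neg, div_eq_mul_inv]

/-- `log ζ` for `Re s > 1` -/
def Lz (s : ℂ) : ℂ := ∑' p : Nat.Primes, -Complex.log (1 - (p : ℂ) ^ (-s))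

/-- general term of the correction factor -/
def Wt (z s : ℂ) (p : Nat.Primes) : ℂ :=
  -Complex.log (1 - z * (p : ℂ) ^ (-s)) + z * Complex.log (1 - (p : ℂ) ^ (-s))

def Wz (z s : ℂ) : ℂ := ∑' p : Nat.Primes, Wt z s p

lemma FL_eq_exp {z s : ℂ} (hz : ‖z‖ ≤ 1) (hs : 1 < s.re) :
    FL z s = Complex.exp (z * Lz s + Wz z s) := by
  have hsum : Summable (‖omHom z s ·‖) := by
    have := (FL_summable hz hs).norm
    refine this.congr fun n => ?_
    rw [omHom_eq_term]
  have h1 := EulerProduct.exp_tsum_primes_log_eq_tsum hsum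
  have h2 : FL z s = ∑' n, omHom z s n := by
    simp_rw [omHom_eq_term]; rfl
  have hp : ∀ p : Nat.Primes, omHom z s p = z * (p : ℂ) ^ (-s) := by
    intro p
    have : bigOmega p = 1 := by
      rw [bigOmega_eq, ArithmeticFunction.cardFactors_apply_prime p.2]
    simp [omHom, p.2.ne_zero, this]
  rw [h2, ← h1]
  congr 1
  simp_rw [hp]
  have hsz : Summable (fun p : Nat.Primes => (p : ℂ) ^ (-s)) := by
    have := (summable_riemannZetaSummand hs).of_norm
    exact this.comp_injective (i := fun p : Nat.Primes => (p : ℕ)) Subtype.val_injective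
  have a1 := hsz.clog_one_sub
  have a2 := (hsz.mul_left z).clog_one_sub
  rw [Lz, Wz, ← tsum_mul_left, ← Summable.tsum_add]
  · apply tsum_congr
    intro p
    rw [Wt]; ring
  · exact a1.neg.mul_left z
  · exact a2.neg.add (a1.mul_left z)

lemma exp_Lz {s : ℂ} (hs : 1 < s.re) : Complex.exp (Lz s) = riemannZeta s :=
  riemannZeta_eulerProduct_exp_log hs

lemma log_quad {z w : ℂ} (hz : ‖z‖ ≤ 3/2) (hw : ‖w‖ ≤ 3/4) (hzw : ‖z * w‖ ≤ 3/4) :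
    ‖-Complex.log (1 - z * w) + z * Complex.log (1 - w)‖ ≤ 8 * ‖w‖ ^ 2 := by
  have key : ∀ u : ℂ, ‖u‖ ≤ 3/4 → ‖Complex.log (1 - u) + u‖ ≤ 2 * ‖u‖ ^ 2 := by
    intro u hu
    have := Complex.norm_log_one_add_sub_self_le (z := -u) (by rw [norm_neg]; linarith)
    rw [norm_neg, ← sub_eq_add_neg, sub_neg_eq_add] at this
    refine this.trans ?_
    have h4 : (1 - ‖u‖)⁻¹ ≤ 4 := by
      rw [inv_le_comm₀ (by linarith) (by norm_num)]; linarith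
    nlinarith [sq_nonneg ‖u‖]
  have e : -Complex.log (1 - z * w) + z * Complex.log (1 - w) =
    -(Complex.log (1 - z * w) + z * w) + z * (Complex.log (1 - w) + w) := by ring
  rw [e]
  refine (norm_add_le _ _).trans ?_
  rw [norm_neg, norm_mul]
  have h1 := key _ hzw
  have h2 := key _ hw
  rw [norm_mul] at h1
  have h3 : ‖z‖ * ‖Complex.log (1 - w) + w‖ ≤ 3/2 * (2 * ‖w‖ ^ 2) :=
    mul_le_mul hz h2 (norm_nonneg _) (by norm_num)
  have h5 : (‖z‖ * ‖w‖) ^ 2 ≤ 9/4 * ‖w‖ ^ 2 := by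
    rw [mul_pow]
    have : ‖z‖ ^ 2 ≤ 9/4 := by nlinarith [norm_nonneg z]
    nlinarith [sq_nonneg ‖w‖]
  linarith [sq_nonneg ‖w‖]

lemma norm_prime_cpow (p : Nat.Primes) (s : ℂ) : ‖(p : ℂ) ^ (-s)‖ = (p : ℝ) ^ (-s.re) := by
  rw [Complex.norm_natCast_cpow_of_pos p.2.pos]; simp

lemma prime_rpow_le (p : Nat.Primes) {σ : ℝ} (hσ : 3/4 ≤ σ) : (p : ℝ) ^ (-σ) ≤ 3/4 := by
  have h2 : (2:ℝ) ≤ p := by exact_mod_cast p.2.two_le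
  have h1 : (p : ℝ) ^ (-σ) ≤ (2:ℝ) ^ (-(3/4) : ℝ) := by
    calc (p : ℝ) ^ (-σ) ≤ (p : ℝ) ^ (-(3/4) : ℝ) :=
          Real.rpow_le_rpow_of_exponent_le (by linarith) (by linarith)
      _ ≤ _ := Real.rpow_le_rpow_of_nonpos (by norm_num) h2 (by norm_num)
  refine h1.trans ?_
  rw [Real.rpow_neg (by norm_num), inv_le_comm₀ (by positivity) (by norm_num)]
  have : (2:ℝ) ^ ((1:ℝ)/2) ≤ 2 ^ ((3:ℝ)/4) :=
    Real.rpow_le_rpow_of_exponent_le (by norm_num) (by norm_num)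
  refine le_trans ?_ this
  rw [← Real.sqrt_eq_rpow]
  apply Real.le_sqrt_of_sq_le; norm_num

lemma summable_primes_rpow {a : ℝ} (ha : 1 < a) :
    Summable (fun p : Nat.Primes => (p : ℝ) ^ (-a)) := by
  have : Summable (fun n : ℕ => (n : ℝ) ^ (-a)) := Real.summable_nat_rpow.2 (by linarith)
  exact this.comp_injective (i := fun p : Nat.Primes => (p : ℕ)) Subtype.val_injective

lemma Wt_bound {z s : ℂ} (hz : ‖z‖ ≤ 1) (hs : 3/4 ≤ s.re) (p : Nat.Primes) :
    ‖Wt z s p‖ ≤ 8 * (p : ℝ) ^ (-(3/2) : ℝ) := by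
  have hp1 : (1:ℝ) ≤ p := by exact_mod_cast p.2.one_le
  have hw : ‖(p : ℂ) ^ (-s)‖ ≤ 3/4 := by
    rw [norm_prime_cpow]; exact prime_rpow_le p hs
  have hzw : ‖z * (p : ℂ) ^ (-s)‖ ≤ 3/4 := by
    rw [norm_mul]
    exact (mul_le_of_le_one_left (norm_nonneg _) hz).trans hw
  refine (log_quad (by linarith) hw hzw).trans ?_
  rw [norm_prime_cpow, ← Real.rpow_natCast, ← Real.rpow_mul (by linarith)]
  gcongr
  push_cast; linarith

def CW : ℝ := ∑' p : Nat.Primes, 8 * (p : ℝ) ^ (-(3/2) : ℝ)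

lemma CW_nonneg : 0 ≤ CW := tsum_nonneg fun p => by positivity

lemma Wz_bound {z s : ℂ} (hz : ‖z‖ ≤ 1) (hs : 3/4 ≤ s.re) : ‖Wz z s‖ ≤ CW :=
  tsum_of_norm_bounded ((summable_primes_rpow (by norm_num)).mul_left 8).hasSum
    (fun p => Wt_bound hz hs p)

lemma one_sub_mem_slit {u : ℂ} (hu : ‖u‖ ≤ 3/4) : 1 - u ∈ Complex.slitPlane := by
  rw [sub_eq_add_neg]
  exact Complex.mem_slitPlane_of_norm_lt_one (by rw [norm_neg]; linarith)

lemma Wz_diff {z : ℂ} (hz : ‖z‖ ≤ 1) : DifferentiableOn ℂ (Wz z) {s | 3/4 < s.re} := by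
  have := Complex.differentiableOn_tsum_of_summable_norm
    (U := {s : ℂ | 3/4 < s.re}) (F := fun (p : Nat.Primes) s => Wt z s p)
    ((summable_primes_rpow (a := 3/2) (by norm_num)).mul_left 8) ?_
    (isOpen_lt continuous_const Complex.continuous_re)
    (fun p s hs => Wt_bound hz (le_of_lt hs) p)
  · exact this
  · intro p s hs
    have hs' : 3/4 ≤ s.re := le_of_lt hs
    have hw : ‖(p : ℂ) ^ (-s)‖ ≤ 3/4 := by
      rw [norm_prime_cpow]; exact prime_rpow_le p hs'
    have hzw : ‖z * (p : ℂ) ^ (-s)‖ ≤ 3/4 := by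
      rw [norm_mul]
      exact (mul_le_of_le_one_left (norm_nonneg _) hz).trans hw
    have hp0 : ((p : ℕ) : ℂ) ≠ 0 := by exact_mod_cast p.2.ne_zero
    have d : DifferentiableAt ℂ (fun s : ℂ => ((p : ℕ) : ℂ) ^ (-s)) s :=
      (differentiableAt_id.neg).const_cpow (Or.inl hp0)
    apply DifferentiableAt.differentiableWithinAt
    unfold Wt
    have h1 := one_sub_mem_slit hw
    have h2 := one_sub_mem_slit hzw
    exact ((((differentiableAt_const _).sub (d.const_mul z)).clog h2).neg).add
      ((((differentiableAt_const _).sub d).clog h1).const_mul z)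

lemma Wz_deriv_bound {z s : ℂ} (hz : ‖z‖ ≤ 1) (hs : 1 ≤ s.re) : ‖deriv (Wz z) s‖ ≤ CW / (1/5) := by
  have hre : ∀ w ∈ Metric.closedBall s (1/5), 3/4 < w.re := by
    intro w hw
    rw [Metric.mem_closedBall, dist_eq_norm] at hw
    have := (Complex.abs_re_le_norm (w - s)).trans hw
    rw [abs_le, Complex.sub_re] at this
    linarith [this.1]
  apply Complex.norm_deriv_le_of_forall_mem_sphere_norm_le (by norm_num)
  · apply DifferentiableOn.diffContOnCl
    rw [closure_ball _ (by norm_num)]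
    exact (Wz_diff hz).mono hre
  · intro w hw
    exact Wz_bound hz (hre w (Metric.sphere_subset_closedBall hw)).le

lemma Wz_diffAt {z s : ℂ} (hz : ‖z‖ ≤ 1) (hs : 1 ≤ s.re) : DifferentiableAt ℂ (Wz z) s := by
  apply (Wz_diff hz).differentiableAt
  apply (isOpen_lt continuous_const Complex.continuous_re).mem_nhds
  show 3/4 < s.re
  linarith

lemma convex_re_ge (a : ℝ) : Convex ℝ {s : ℂ | a ≤ s.re} := convex_halfSpace_re_ge a
lemma convex_re_gt (a : ℝ) : Convex ℝ {s : ℂ | a < s.re} := convex_halfSpace_re_gt a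

lemma Wz_lip {z s t : ℂ} (hz : ‖z‖ ≤ 1) (hs : 1 ≤ s.re) (ht : 1 ≤ t.re) :
    ‖Wz z s - Wz z t‖ ≤ CW / (1/5) * ‖s - t‖ :=
  (convex_re_ge 1).norm_image_sub_le_of_norm_deriv_le (fun x hx => Wz_diffAt hz hx)
    (fun x hx => Wz_deriv_bound hz hx) ht hs

def zt (n : ℕ) (s : ℂ) : ℂ :=
  ((n + 1 : ℝ) : ℂ) ^ (-s) - (((n + 2 : ℝ) : ℂ) ^ (1 - s) - ((n + 1 : ℝ) : ℂ) ^ (1 - s)) / (1 - s)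

lemma min_le_rpow {x : ℝ} (hx : 0 < x) : min 2 x ≤ 2 * x ^ (1/40 : ℝ) := by
  rcases le_total x 1 with h | h
  · have : x ^ (1:ℝ) ≤ x ^ (1/40 : ℝ) := Real.rpow_le_rpow_of_exponent_ge hx h (by norm_num)
    rw [Real.rpow_one] at this
    have := min_le_right 2 x
    linarith
  · have : 1 ≤ x ^ (1/40 : ℝ) := Real.one_le_rpow h (by norm_num)
    have := min_le_left 2 x
    linarith

lemma zt_aux {m : ℝ} (hm : 1 ≤ m) {s : ℂ} (hs : 1 - 1/80 ≤ s.re) {u : ℝ} (hu : u ∈ Set.Icc m (m+1)) :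
    ‖(m : ℂ) ^ (-s) - (u : ℂ) ^ (-s)‖ ≤ 2 * ‖s‖ ^ (1/40 : ℝ) * m ^ (-(1 + 1/80) : ℝ) := by
  have hm0 : 0 < m := by linarith
  have hu0 : 0 < u := by linarith [hu.1]
  have hs0 : 0 < ‖s‖ := by
    have := Complex.re_le_norm s
    linarith
  have hpow : ∀ v : ℝ, m ≤ v → ∀ w : ℂ, w.re ≤ 0 → ‖(v : ℂ) ^ w‖ ≤ m ^ w.re := fun v hv w hw => by
    rw [Complex.norm_cpow_eq_rpow_re_of_pos (by linarith)]
    exact Real.rpow_le_rpow_of_nonpos hm0 hv hw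
  have h1 : ‖(m : ℂ) ^ (-s) - (u : ℂ) ^ (-s)‖ ≤ 2 * m ^ (-s.re) := by
    refine (norm_sub_le _ _).trans ?_
    have a := hpow m le_rfl (-s) (by simp; linarith)
    have b := hpow u hu.1 (-s) (by simp; linarith)
    simp only [Complex.neg_re] at a b
    linarith
  have h2 : ‖(m : ℂ) ^ (-s) - (u : ℂ) ^ (-s)‖ ≤ ‖s‖ * m ^ (-s.re - 1) := by
    have hd : ∀ x ∈ Set.Icc m (m+1), HasDerivWithinAt (fun v : ℝ => (v : ℂ) ^ (-s)) (-s * (x : ℂ) ^ (-s - 1)) (Set.Icc m (m+1)) x := by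
      intro x hx
      have hx0 : 0 < x := by linarith [hx.1]
      have := (hasDerivAt_id (x:ℂ)).cpow_const (c := -s) (Or.inl (by simpa using hx0))
      simpa using this.comp_ofReal.hasDerivWithinAt
    have := Convex.norm_image_sub_le_of_norm_hasDerivWithin_le (C := ‖s‖ * m ^ (-s.re - 1)) hd ?_ (convex_Icc m (m+1)) hu (Set.left_mem_Icc.2 (by linarith))
    · refine this.trans ?_
      have h3 : ‖m - u‖ ≤ 1 := by
        rw [Real.norm_eq_abs, abs_le]; constructor <;> linarith [hu.1, hu.2]
      exact mul_le_of_le_one_right (by positivity) h3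
    · intro x hx
      rw [norm_mul, norm_neg]
      have := hpow x hx.1 (-s-1) (by simp; linarith)
      simp only [Complex.sub_re, Complex.neg_re, Complex.one_re] at this
      gcongr
  have h3 := min_le_rpow (x := ‖s‖ / m) (by positivity)
  have h4 : m ^ (-s.re - 1) = m ^ (-s.re) / m := by
    rw [Real.rpow_sub_one hm0.ne']
  calc _ ≤ m ^ (-s.re) * min 2 (‖s‖/m) := by
        rw [mul_min_of_nonneg _ _ (by positivity)]
        refine le_min (by linarith) ?_
        rw [h4] at h2
        calc _ ≤ _ := h2
          _ = _ := by ring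
    _ ≤ m ^ (-s.re) * (2 * (‖s‖/m) ^ (1/40 : ℝ)) := by gcongr
    _ = 2 * ‖s‖ ^ (1/40 : ℝ) * (m ^ (-s.re) * m ^ (-(1/40) : ℝ)) := by
        rw [Real.div_rpow hs0.le hm0.le, Real.rpow_neg hm0.le (1/40)]; ring
    _ = 2 * ‖s‖ ^ (1/40 : ℝ) * m ^ (-s.re + -(1/40) : ℝ) := by rw [Real.rpow_add hm0]
    _ ≤ _ := by
        gcongr
        linarith

lemma zt_bound (n : ℕ) {s : ℂ} (hs : 1 - 1/80 ≤ s.re) (hs1 : s ≠ 1) :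
    ‖zt n s‖ ≤ 2 * ‖s‖ ^ (1/40 : ℝ) * ((n:ℝ) + 1) ^ (-(1 + 1/80) : ℝ) := by
  set m : ℝ := n + 1 with hm
  have hm1 : 1 ≤ m := by simp [hm]
  have hs2 : 1 - s ≠ 0 := sub_ne_zero.2 hs1.symm
  have hd : ∀ x ∈ Set.Icc m (m+1), HasDerivWithinAt (fun v : ℝ => (v:ℂ) * (m:ℂ)^(-s) - (v : ℂ) ^ (1-s) / (1-s)) ((m:ℂ)^(-s) - (x : ℂ) ^ (-s)) (Set.Icc m (m+1)) x := by
    intro x hx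
    have hx0 : 0 < x := by linarith [hx.1]
    have h1 := (hasDerivAt_id (x:ℂ)).cpow_const (c := 1-s) (Or.inl (by simpa using hx0))
    have h2 := ((hasDerivAt_id (x:ℂ)).mul_const ((m:ℂ)^(-s))).sub (h1.div_const (1-s))
    have h3 := h2.comp_ofReal.hasDerivWithinAt (s := Set.Icc m (m+1))
    refine h3.congr_deriv ?_
    simp only [id, one_mul, mul_one]
    rw [show (1 - s - 1 : ℂ) = -s by ring]
    field_simp
  have := Convex.norm_image_sub_le_of_norm_hasDerivWithin_le hd (fun x hx => zt_aux hm1 hs hx) (convex_Icc m (m+1)) (Set.left_mem_Icc.2 (by linarith)) (Set.right_mem_Icc.2 (by linarith))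
  convert this using 1
  · congr 1
    simp only [zt, hm]
    push_cast
    rw [show (n:ℂ) + 1 + 1 = n + 2 by ring]
    ring
  · simp

lemma summable_zb : Summable fun n : ℕ => ((n:ℝ) + 1) ^ (-(1 + 1/80) : ℝ) := by
  have := (summable_nat_add_iff 1).2 (Real.summable_nat_rpow (p := (-(1 + 1/80) : ℝ)).2 (by norm_num))
  simpa using this

def CZ : ℝ := ∑' n : ℕ, ((n:ℝ) + 1) ^ (-(1 + 1/80) : ℝ)
lemma CZ_nonneg : 0 ≤ CZ := tsum_nonneg fun n => by positivity

def Zs (s : ℂ) : ℂ := ∑' n, zt n s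

lemma Zs_bound {s : ℂ} (hs : 1 - 1/80 ≤ s.re) (hs1 : s ≠ 1) : ‖Zs s‖ ≤ 2 * ‖s‖ ^ (1/40 : ℝ) * CZ := by
  refine tsum_of_norm_bounded ?_ (fun n => zt_bound n hs hs1)
  exact summable_zb.hasSum.mul_left _

lemma Zs_eq {s : ℂ} (hs : 1 < s.re) : Zs s = riemannZeta s - 1 / (s - 1) := by
  have hs1 : s ≠ 1 := fun h => by simp [h] at hs
  have hs2 : 1 - s ≠ 0 := sub_ne_zero.2 hs1.symm
  have hsum : Summable fun n => zt n s :=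
    Summable.of_norm_bounded (summable_zb.mul_left (2 * ‖s‖ ^ (1/40 : ℝ))) (fun n => zt_bound n (by linarith) hs1)
  have h1 := hsum.hasSum.tendsto_sum_nat
  have hz : HasSum (fun n : ℕ => 1 / ((n:ℂ) + 1) ^ s) (riemannZeta s) := by
    rw [zeta_eq_tsum_one_div_nat_add_one_cpow hs]
    have := (summable_nat_add_iff 1).2 (Complex.summable_one_div_nat_cpow.2 hs)
    push_cast at this
    exact this.hasSum
  have h2 := hz.tendsto_sum_nat
  have h3 : ∀ N : ℕ, ∑ n ∈ Finset.range N, zt n s = ∑ n ∈ Finset.range N, 1 / ((n:ℂ) + 1) ^ s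
      - (((N + 1 : ℝ) : ℂ) ^ (1 - s) - 1) / (1 - s) := by
    intro N
    induction N with
    | zero => simp
    | succ N ih =>
      rw [Finset.sum_range_succ, Finset.sum_range_succ, ih]
      simp only [zt]
      rw [Complex.cpow_neg]
      push_cast
      rw [show (N:ℂ) + 1 + 1 = N + 2 by ring]
      ring
  have h4 : Filter.Tendsto (fun N : ℕ => ((N + 1 : ℝ) : ℂ) ^ (1 - s)) Filter.atTop (nhds 0) := by
    rw [tendsto_zero_iff_norm_tendsto_zero]
    have : ∀ N : ℕ, ‖((N + 1 : ℝ) : ℂ) ^ (1 - s)‖ = ((N:ℝ)+1) ^ (-(s.re - 1)) := fun N => by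
      rw [Complex.norm_cpow_eq_rpow_re_of_pos (by positivity)]; simp
    simp_rw [this]
    have h5 := (tendsto_rpow_neg_atTop (y := s.re - 1) (by linarith)).comp (Filter.tendsto_atTop_add_const_right _ (1:ℝ) tendsto_natCast_atTop_atTop)
    exact h5
  have h6 := h2.sub ((h4.sub_const 1).div_const (1 - s))
  have h7 := tendsto_nhds_unique h1 (by simpa only [h3] using h6)
  rw [Zs, h7]
  have : s - 1 ≠ 0 := sub_ne_zero.2 hs1
  field_simp
  ring

lemma Zs_deriv_bound {s : ℂ} (hs : 1 ≤ s.re) (hy : 1 ≤ |s.im|) :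
    ‖deriv Zs s‖ ≤ 2 * (‖s‖ + 1) ^ (1/40 : ℝ) * CZ / (1/100) := by
  have key : ∀ w ∈ Metric.ball s (1/80), 1 - 1/80 ≤ w.re ∧ w ≠ 1 ∧ ‖w‖ ≤ ‖s‖ + 1 := by
    intro w hw
    rw [Metric.mem_ball, dist_eq_norm] at hw
    have h1 := (Complex.abs_re_le_norm (w - s)).trans_lt hw
    have h2 := (Complex.abs_im_le_norm (w - s)).trans_lt hw
    rw [Complex.sub_re, abs_lt] at h1
    rw [Complex.sub_im] at h2
    refine ⟨by linarith [h1.1], ?_, ?_⟩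
    · rintro rfl
      simp at h2
      linarith
    · have := norm_le_norm_add_norm_sub' w s
      linarith
  have hdiff : DifferentiableOn ℂ Zs (Metric.ball s (1/80)) := by
    refine Complex.differentiableOn_tsum_of_summable_norm (summable_zb.mul_left (2 * (‖s‖+1) ^ (1/40 : ℝ))) ?_ Metric.isOpen_ball ?_
    · intro n w hw
      have hw2 : 1 - w ≠ 0 := sub_ne_zero.2 (key w hw).2.1.symm
      refine DifferentiableAt.differentiableWithinAt ?_
      unfold zt
      have e1 : ((n + 1 : ℝ) : ℂ) ≠ 0 := by
        rw [Complex.ofReal_ne_zero]; positivity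
      have e2 : ((n + 2 : ℝ) : ℂ) ≠ 0 := by
        rw [Complex.ofReal_ne_zero]; positivity
      refine DifferentiableAt.sub ?_ (DifferentiableAt.div (DifferentiableAt.sub ?_ ?_) (by fun_prop) hw2)
      · exact DifferentiableAt.const_cpow (by fun_prop) (Or.inl e1)
      · exact DifferentiableAt.const_cpow (by fun_prop) (Or.inl e2)
      · exact DifferentiableAt.const_cpow (by fun_prop) (Or.inl e1)
    · intro n w hw
      obtain ⟨h1, h2, h3⟩ := key w hw
      refine (zt_bound n h1 h2).trans ?_
      gcongr
  refine Complex.norm_deriv_le_of_forall_mem_sphere_norm_le (by norm_num) (hdiff.diffContOnCl_ball (Metric.closedBall_subset_ball (by norm_num))) ?_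
  intro w hw
  have hw' : w ∈ Metric.ball s (1/80) := Metric.sphere_subset_closedBall.trans (Metric.closedBall_subset_ball (by norm_num)) hw
  obtain ⟨h1, h2, h3⟩ := key w hw'
  refine (Zs_bound h1 h2).trans ?_
  have := CZ_nonneg
  gcongr

lemma norm_le_two_mul {s : ℂ} (h1 : 1 ≤ s.re) (h2 : s.re ≤ 2) (hy : 1 ≤ |s.im|) : ‖s‖ + 1 ≤ 4 * |s.im| := by
  have := Complex.norm_le_abs_re_add_abs_im s
  rw [abs_of_nonneg (by linarith : 0 ≤ s.re)] at this
  linarith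

lemma rpow_four_mul {x y : ℝ} (hx : 0 ≤ x) (hxy : x ≤ 4 * y) (hy : 0 ≤ y) : x ^ (1/40 : ℝ) ≤ 4 * y ^ (1/40 : ℝ) := by
  calc x ^ (1/40 : ℝ) ≤ (4 * y) ^ (1/40 : ℝ) := by gcongr
    _ = 4 ^ (1/40 : ℝ) * y ^ (1/40 : ℝ) := by rw [Real.mul_rpow (by norm_num) hy]
    _ ≤ 4 ^ (1 : ℝ) * y ^ (1/40 : ℝ) := by
      gcongr
      · norm_num
      · norm_num
    _ = _ := by rw [Real.rpow_one]

lemma zeta_bounds : ∃ C : ℝ, 1 ≤ C ∧ (∀ s : ℂ, 1 < s.re → s.re ≤ 2 → 1 ≤ |s.im| →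
    ‖riemannZeta s‖ ≤ C * |s.im| ^ (1/40 : ℝ) ∧ ‖deriv riemannZeta s‖ ≤ C * |s.im| ^ (1/40 : ℝ)) ∧
    (∀ s : ℂ, 1 < s.re → s.re ≤ 2 → s.im = 0 → ‖riemannZeta s‖ ≤ C / (s.re - 1)) := by
  have hK : IsCompact (Set.Icc (1:ℝ) 2) := isCompact_Icc
  obtain ⟨M, hM⟩ := hK.exists_bound_of_continuousOn (f := fun x : ℝ => riemannZeta₀ x)
    (differentiable_riemannZeta₀.continuous.comp Complex.continuous_ofReal).continuousOn
  have hM0 : 0 ≤ M := (norm_nonneg _).trans (hM 1 (by simp))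
  have hCZ := CZ_nonneg
  refine ⟨1 + 800 * CZ + M, by linarith, ?_, ?_⟩
  · intro s h1 h2 hy
    have hs1 : s ≠ 1 := fun h => by simp [h] at h1
    have hq : 1 ≤ |s.im| ^ (1/40 : ℝ) := Real.one_le_rpow hy (by norm_num)
    have hn : 1 ≤ ‖s - 1‖ := by
      have := Complex.abs_im_le_norm (s - 1)
      simp at this
      linarith
    have hb := rpow_four_mul (by positivity) (norm_le_two_mul h1.le h2 hy) (by positivity)
    have hb' : ‖s‖ ^ (1/40 : ℝ) ≤ (‖s‖ + 1) ^ (1/40 : ℝ) := by gcongr; linarith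
    have hfin : ∀ x : ℝ, x ≤ 1 + 2 * (‖s‖+1) ^ (1/40 : ℝ) * CZ / (1/100) →
        x ≤ (1 + 800 * CZ + M) * |s.im| ^ (1/40 : ℝ) := by
      intro x hx
      have a1 := mul_le_mul_of_nonneg_right hb hCZ
      have a2 := mul_nonneg hM0 (zero_le_one.trans hq)
      nlinarith
    constructor
    · have : riemannZeta s = Zs s + 1 / (s - 1) := by rw [Zs_eq h1]; ring
      apply hfin
      rw [this]
      refine (norm_add_le _ _).trans ?_
      have h3 := Zs_bound (s := s) (by linarith) hs1
      have h4 : ‖1 / (s - 1)‖ ≤ 1 := by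
        rw [norm_div, norm_one, div_le_one (by linarith)]; exact hn
      have a1 := mul_le_mul_of_nonneg_right hb' hCZ
      have a2 : 0 ≤ (‖s‖+1) ^ (1/40 : ℝ) * CZ := by positivity
      linarith
    · have hev : Zs =ᶠ[nhds s] fun w => riemannZeta w - 1 / (w - 1) := by
        filter_upwards [(isOpen_lt continuous_const Complex.continuous_re).mem_nhds h1] with w hw
        exact Zs_eq hw
      have h0 : s - 1 ≠ 0 := sub_ne_zero.2 hs1
      have hd1 : HasDerivAt (fun w : ℂ => 1 / (w - 1)) (-1 / (s - 1)^2) s := by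
        have := ((hasDerivAt_id s).sub_const 1).fun_inv h0
        simpa [one_div] using this
      have hd := hev.deriv_eq
      rw [deriv_fun_sub (differentiableAt_riemannZeta hs1) hd1.differentiableAt, hd1.deriv] at hd
      have : deriv riemannZeta s = deriv Zs s + -1 / (s - 1)^2 := by rw [hd]; ring
      apply hfin
      rw [this]
      refine (norm_add_le _ _).trans ?_
      have h3 := Zs_deriv_bound h1.le hy
      have h4 : ‖-1 / (s - 1)^2‖ ≤ 1 := by
        rw [norm_div, norm_neg, norm_one, norm_pow]
        rw [div_le_one (by positivity)]
        nlinarith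
      linarith
  · intro s h1 h2 hy
    have hs1 : s ≠ 1 := fun h => by simp [h] at h1
    have hsr : s = (s.re : ℂ) := Complex.ext (by simp) (by simp [hy])
    rw [riemannZeta_eq_inv_sub_add hs1, le_div_iff₀ (by linarith)]
    have h3 := hM s.re ⟨h1.le, h2⟩
    rw [← hsr] at h3
    have h4 : ‖(s - 1)⁻¹‖ = (s.re - 1)⁻¹ := by
      rw [hsr, norm_inv]
      norm_cast
      rw [Real.norm_eq_abs, abs_of_pos (by simpa using h1)]
    have h5 := norm_add_le (s - 1)⁻¹ (riemannZeta₀ s)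
    rw [h4] at h5
    have h6 : (s.re - 1)⁻¹ * (s.re - 1) = 1 := inv_mul_cancel₀ (by linarith)
    have h7 : (0:ℝ) < s.re - 1 := by linarith
    calc _ ≤ ((s.re - 1)⁻¹ + M) * (s.re - 1) := by gcongr; linarith
      _ = 1 + M * (s.re - 1) := by rw [add_mul, h6]
      _ ≤ _ := by nlinarith

lemma zeta_341 {x : ℝ} (hx : 0 < x) (y : ℝ) :
    1 ≤ ‖riemannZeta (1 + x)‖ ^ 3 * ‖riemannZeta (1 + x + Complex.I * y)‖ ^ 4 * ‖riemannZeta (1 + x + 2 * Complex.I * y)‖ := by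
  have := DirichletCharacter.norm_LFunction_product_ge_one (N := 1) 1 hx y
  simpa [DirichletCharacter.LFunctionTrivChar, DirichletCharacter.LFunction_modOne_eq] using this

lemma zeta_lower : ∃ a : ℝ, 0 < a ∧ ∀ s : ℂ, 1 < s.re → s.re ≤ 2 → 1 ≤ |s.im| →
    a / (|s.im| ^ (1/40 : ℝ)) ^ 4 ≤ ‖riemannZeta s‖ := by
  obtain ⟨C, hC, h1, h2⟩ := zeta_bounds
  have hC0 : 0 < C := by linarith
  set D : ℝ := 1 / (2 * C) with hD
  set b : ℝ := D / (2 * C) with hb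
  have hD0 : 0 < D := by positivity
  have hb0 : 0 < b := by positivity
  have hD4 : D ^ 4 * (2 * C ^ 4) ≤ 1 := by
    rw [hD]; field_simp; norm_num
  have hbD : C * b = D / 2 := by rw [hb]; field_simp
  -- first range
  have far : ∀ s : ℂ, 1 < s.re → s.re ≤ 2 → 1 ≤ |s.im| → 
      b ^ 4 / (|s.im| ^ (1/40 : ℝ)) ^ 5 ≤ s.re - 1 → b ^ 3 * D / (|s.im| ^ (1/40 : ℝ)) ^ 4 ≤ ‖riemannZeta s‖ := by
    intro s hs1 hs2 hy hx
    set q := |s.im| ^ (1/40 : ℝ) with hq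
    have hq1 : 1 ≤ q := Real.one_le_rpow hy (by norm_num)
    have hq0 : 0 < q := by linarith
    set x := s.re - 1 with hxd
    have hx0 : 0 < x := by simp [hxd]; linarith
    have h3 := zeta_341 hx0 s.im
    have e1 : (1 + (x:ℂ)).re = s.re := by simp [hxd]
    have e2 : 1 + (x:ℂ) + Complex.I * s.im = s := by
      apply Complex.ext <;> simp [hxd]
    have e3 : (1 + (x:ℂ) + 2 * Complex.I * s.im).re = s.re := by simp [hxd]
    have e4 : (1 + (x:ℂ) + 2 * Complex.I * s.im).im = 2 * s.im := by simp
    rw [e2] at h3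
    have h4 := h2 (1 + x) (by rw [e1]; exact hs1) (by rw [e1]; exact hs2) (by simp)
    rw [e1, ← hxd] at h4
    have h5 := (h1 (1 + (x:ℂ) + 2 * Complex.I * s.im) (by rw [e3]; exact hs1) (by rw [e3]; exact hs2) (by rw [e4, abs_mul]; simp; linarith)).1
    rw [e4] at h5
    have h6 : |2 * s.im| ^ (1/40 : ℝ) ≤ 2 * q := by
      rw [abs_mul, abs_two, Real.mul_rpow (by norm_num) (abs_nonneg _)]
      gcongr
      calc (2:ℝ) ^ (1/40 : ℝ) ≤ 2 ^ (1:ℝ) := by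
            gcongr
            · norm_num
            · norm_num
        _ = 2 := by simp
    have h7 : ‖riemannZeta (1 + (x:ℂ) + 2 * Complex.I * s.im)‖ ≤ C * (2 * q) := h5.trans (by gcongr)
    have h8 : 1 ≤ (C / x) ^ 3 * ‖riemannZeta s‖ ^ 4 * (C * (2 * q)) := h3.trans (by gcongr)
    have h9 : x ^ 3 ≤ ‖riemannZeta s‖ ^ 4 * (2 * C ^ 4 * q) := by
      calc x ^ 3 = x ^ 3 * 1 := by ring
        _ ≤ x ^ 3 * ((C / x) ^ 3 * ‖riemannZeta s‖ ^ 4 * (C * (2 * q))) := by gcongr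
        _ = _ := by field_simp
    have h10 : (b ^ 4 / q ^ 5) ^ 3 ≤ x ^ 3 := by gcongr
    refine le_of_pow_le_pow_left₀ (n := 4) (by norm_num) (norm_nonneg _) ?_
    have h11 : (b ^ 3 * D / q ^ 4) ^ 4 * (2 * C ^ 4 * q) ≤ ‖riemannZeta s‖ ^ 4 * (2 * C ^ 4 * q) := by
      calc (b ^ 3 * D / q ^ 4) ^ 4 * (2 * C ^ 4 * q) = (b ^ 4 / q ^ 5) ^ 3 * (D ^ 4 * (2 * C ^ 4)) := by
            field_simp
        _ ≤ (b ^ 4 / q ^ 5) ^ 3 * 1 := by gcongr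
        _ ≤ _ := by linarith
    exact le_of_mul_le_mul_right h11 (by positivity)
  refine ⟨b ^ 3 * D / 2, by positivity, ?_⟩
  intro s hs1 hs2 hy
  have hb1 : b ≤ 1 := by
    rw [hb, hD, div_div, div_le_one (by positivity)]; nlinarith
  set q := |s.im| ^ (1/40 : ℝ) with hq
  have hq1 : 1 ≤ q := Real.one_le_rpow hy (by norm_num)
  have hq0 : 0 < q := by linarith
  by_cases hx : b ^ 4 / q ^ 5 ≤ s.re - 1
  · refine le_trans ?_ (far s hs1 hs2 hy hx)
    rw [← hq]
    gcongr
    have : 0 < b ^ 3 * D := by positivity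
    linarith
  · push Not at hx
    have hle1 : b ^ 4 / q ^ 5 ≤ 1 := by
      rw [div_le_one (by positivity)]
      exact (pow_le_one₀ hb0.le hb1).trans (one_le_pow₀ hq1)
    have hpos : 0 < b ^ 4 / q ^ 5 := by positivity
    set x0 := b ^ 4 / q ^ 5 with hx0
    set s0 : ℂ := ⟨1 + x0, s.im⟩ with hs0
    have h3 := far s0 (by simp [hs0]; linarith) (by simp [hs0]; linarith) hy (by
      change b ^ 4 / q ^ 5 ≤ 1 + x0 - 1
      linarith)
    have h3' : b ^ 3 * D / q ^ 4 ≤ ‖riemannZeta s0‖ := h3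
    -- mean value along the segment
    have hseg : ∀ w ∈ segment ℝ s s0, 1 < w.re ∧ w.re ≤ 2 ∧ w.im = s.im := by
      intro w hw
      obtain ⟨u, v, hu, hv, huv, rfl⟩ := hw
      have hu' : u = 1 - v := by linarith
      subst hu'
      simp only [Complex.add_re, Complex.real_smul, Complex.re_ofReal_mul, Complex.add_im, Complex.im_ofReal_mul, hs0]
      refine ⟨?_, ?_, by ring⟩
      · nlinarith
      · nlinarith
    have hmv := (convex_segment (𝕜 := ℝ) s s0).norm_image_sub_le_of_norm_deriv_le (𝕜 := ℂ) (f := riemannZeta) (C := C * q)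
      (fun w hw => differentiableAt_riemannZeta (fun h => by have := (hseg w hw).1; simp [h] at this))
      (fun w hw => by
        obtain ⟨a1, a2, a3⟩ := hseg w hw
        have := (h1 w a1 a2 (by rw [a3]; exact hy)).2
        rwa [a3] at this) (left_mem_segment ℝ s s0) (right_mem_segment ℝ s s0)
    have hdist : ‖s0 - s‖ ≤ x0 := by
      have : s0 - s = ((1 + x0 - s.re : ℝ) : ℂ) := by apply Complex.ext <;> simp [hs0]
      rw [this, Complex.norm_real, Real.norm_eq_abs, abs_of_pos (by linarith)]
      linarith
    have h4 : ‖riemannZeta s0 - riemannZeta s‖ ≤ b ^ 3 * D / 2 / q ^ 4 := by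
      calc _ ≤ _ := hmv
        _ ≤ C * q * x0 := by gcongr
        _ = (C * b) * b ^ 3 / q ^ 4 := by rw [hx0]; field_simp
        _ = _ := by rw [hbD]; ring
    have h5 := norm_le_norm_add_norm_sub' (riemannZeta s0) (riemannZeta s)
    have h6 : b ^ 3 * D / q ^ 4 = b ^ 3 * D / 2 / q ^ 4 + b ^ 3 * D / 2 / q ^ 4 := by ring
    linarith

lemma norm_prime_le_half {s : ℂ} (hs : 1 ≤ s.re) (p : Nat.Primes) : ‖(p : ℂ) ^ (-s)‖ ≤ 1/2 := by
  rw [norm_prime_cpow]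
  have h2 : (2:ℝ) ≤ p := by exact_mod_cast p.2.two_le
  calc (p:ℝ) ^ (-s.re) ≤ (p:ℝ) ^ (-1:ℝ) := by
        gcongr
        linarith
    _ = (p:ℝ)⁻¹ := by rw [Real.rpow_neg_one]
    _ ≤ _ := by rw [one_div]; gcongr

lemma Lz_diff {s : ℂ} (hs : 1 < s.re) : DifferentiableAt ℂ Lz s := by
  set a := (1 + s.re) / 2 with ha
  have ha1 : 1 < a := by simp [ha]; linarith
  have has : a < s.re := by simp [ha]; linarith
  have hopen : IsOpen {w : ℂ | a < w.re} := isOpen_lt continuous_const Complex.continuous_re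
  have : DifferentiableOn ℂ Lz {w : ℂ | a < w.re} := by
    refine Complex.differentiableOn_tsum_of_summable_norm ((summable_primes_rpow ha1).mul_left (3/2)) ?_ hopen ?_
    · intro p w hw
      have hw' : a < w.re := hw
      refine DifferentiableAt.differentiableWithinAt ?_
      have h1 : DifferentiableAt ℂ (fun w : ℂ => (p:ℂ) ^ (-w)) w :=
        DifferentiableAt.const_cpow (by fun_prop) (Or.inl (by exact_mod_cast p.2.ne_zero))
      exact ((h1.const_sub 1).clog (one_sub_mem_slit ((norm_prime_le_half (by linarith) p).trans (by norm_num)))).neg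
    · intro p w hw
      have hw' : a < w.re := hw
      have h1 := Complex.norm_log_one_add_half_le_self (z := -(p:ℂ) ^ (-w)) (by rw [norm_neg]; exact norm_prime_le_half (by linarith) p)
      rw [norm_neg, ← sub_eq_add_neg] at h1
      rw [norm_neg]
      refine h1.trans ?_
      rw [norm_prime_cpow]
      gcongr
      exact_mod_cast p.2.one_le
  exact this.differentiableAt (hopen.mem_nhds has)

lemma Lz_deriv {s : ℂ} (hs : 1 < s.re) : deriv Lz s = deriv riemannZeta s / riemannZeta s := by
  have hev : (fun w => Complex.exp (Lz w)) =ᶠ[nhds s] riemannZeta := by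
    filter_upwards [(isOpen_lt continuous_const Complex.continuous_re).mem_nhds hs] with w hw
    exact exp_Lz hw
  have h1 := hev.deriv_eq
  have h2 := (Lz_diff hs).hasDerivAt.cexp.deriv
  rw [h2, exp_Lz hs] at h1
  rw [← h1, mul_div_cancel_left₀]
  exact riemannZeta_ne_zero_of_one_le_re hs.le

lemma FL_hasDeriv {z s : ℂ} (hz : ‖z‖ ≤ 1) (hs : 1 < s.re) :
    HasDerivAt (FL z) (FL z s * (z * deriv Lz s + deriv (Wz z) s)) s := by
  have hev : FL z =ᶠ[nhds s] fun w => Complex.exp (z * Lz w + Wz z w) := by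
    filter_upwards [(isOpen_lt continuous_const Complex.continuous_re).mem_nhds hs] with w hw
    exact FL_eq_exp hz hw
  rw [FL_eq_exp hz hs]
  refine HasDerivAt.congr_of_eventuallyEq ?_ hev
  exact (((Lz_diff hs).hasDerivAt.const_mul z).add (Wz_diffAt hz hs.le).hasDerivAt).cexp

lemma FL_norm_le {z s : ℂ} (hz : ‖z‖ ≤ 1) (hs : 1 < s.re) : ‖FL z s‖ ≤ ‖riemannZeta s.re‖ := by
  have h1 : (1:ℝ) < (s.re : ℂ).re := by simpa using hs
  have h2 : Summable fun n : ℕ => 1 / (n:ℝ) ^ s.re := Real.summable_one_div_nat_rpow.2 hs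
  have h3 : riemannZeta s.re = ((∑' n : ℕ, 1 / (n:ℝ) ^ s.re : ℝ) : ℂ) := by
    rw [zeta_eq_tsum_one_div_nat_cpow h1, Complex.ofReal_tsum]
    refine tsum_congr fun n => ?_
    push_cast
    rw [Complex.ofReal_cpow (by positivity)]
    simp
  rw [h3, Complex.norm_real, Real.norm_of_nonneg (tsum_nonneg fun n => by positivity)]
  refine tsum_of_norm_bounded h2.hasSum fun n => ?_
  rw [LSeries.norm_term_eq]
  split_ifs with h
  · positivity
  · gcongr
    exact norm_zpow_le hz n

lemma FL_far : ∃ C : ℝ, 0 ≤ C ∧ ∀ z s : ℂ, ‖z‖ ≤ 1 → 1 < s.re → s.re ≤ 2 → 1 ≤ |s.im| →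
    ‖deriv (FL z) s‖ ≤ C * |s.im| ^ (1/4 : ℝ) := by
  obtain ⟨C, hC, h1, h2⟩ := zeta_bounds
  obtain ⟨a, ha, hlow⟩ := zeta_lower
  have hC0 : 0 < C := by linarith
  have hCW := CW_nonneg
  set C1 : ℝ := C / a + CW / (1/5) with hC1
  have hC10 : 0 ≤ C1 := by positivity
  have hA : ∀ z s : ℂ, ‖z‖ ≤ 1 → 1 < s.re → s.re ≤ 2 → 1 ≤ |s.im| →
      ‖z * deriv Lz s + deriv (Wz z) s‖ ≤ C1 * (|s.im| ^ (1/40 : ℝ)) ^ 5 := by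
    intro z s hz hs1 hs2 hy
    set q := |s.im| ^ (1/40 : ℝ) with hq
    have hq1 : 1 ≤ q := Real.one_le_rpow hy (by norm_num)
    have hq0 : 0 < q := by linarith
    have e1 : ‖deriv Lz s‖ ≤ C / a * q ^ 5 := by
      rw [Lz_deriv hs1, norm_div]
      calc _ ≤ C * q / (a / q ^ 4) := by
            gcongr
            · exact (h1 s hs1 hs2 hy).2
            · exact hlow s hs1 hs2 hy
        _ = _ := by field_simp
    have e2 := Wz_deriv_bound hz hs1.le
    have e3 : CW / (1/5) ≤ CW / (1/5) * q ^ 5 := le_mul_of_one_le_right (by positivity) (one_le_pow₀ hq1)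
    calc _ ≤ ‖z‖ * ‖deriv Lz s‖ + ‖deriv (Wz z) s‖ := by
          refine (norm_add_le _ _).trans ?_
          rw [norm_mul]
      _ ≤ 1 * (C / a * q ^ 5) + CW / (1/5) * q ^ 5 := by gcongr; linarith
      _ = _ := by rw [hC1]; ring
  have hF : ∀ z s : ℂ, ‖z‖ ≤ 1 → 1 < s.re → s.re ≤ 2 → 1 ≤ |s.im| →
      ‖FL z s‖ ≤ Real.exp C1 * C * (|s.im| ^ (1/40 : ℝ)) ^ 5 := by
    intro z s hz hs1 hs2 hy
    set q := |s.im| ^ (1/40 : ℝ) with hq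
    have hq1 : 1 ≤ q := Real.one_le_rpow hy (by norm_num)
    have hq0 : 0 < q := by linarith
    have hex : 1 ≤ Real.exp C1 := Real.one_le_exp hC10
    have base : ∀ s : ℂ, 1 < s.re → s.re ≤ 2 → 1 / q ^ 5 ≤ s.re - 1 → ‖FL z s‖ ≤ C * q ^ 5 := by
      intro s hs1 hs2 hx
      refine (FL_norm_le hz hs1).trans ?_
      refine (h2 s.re (by simpa using hs1) (by simpa using hs2) (by simp)).trans ?_
      simp only [Complex.ofReal_re]
      calc _ ≤ C / (1 / q ^ 5) := by gcongr
        _ = _ := by field_simp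
    by_cases hx : 1 / q ^ 5 ≤ s.re - 1
    · refine (base s hs1 hs2 hx).trans ?_
      rw [mul_assoc]
      exact le_mul_of_one_le_left (by positivity) hex
    · push Not at hx
      have hle1 : 1 / q ^ 5 ≤ 1 := by
        rw [div_le_one (by positivity)]
        exact one_le_pow₀ hq1
      have hpos : 0 < 1 / q ^ 5 := by positivity
      set x0 := 1 / q ^ 5 with hx0
      set s0 : ℂ := ⟨1 + x0, s.im⟩ with hs0
      have hs01 : 1 < s0.re := by simp [hs0, hpos]
      have h3 := base s0 hs01 (by simp [hs0]; linarith) (by simp [hs0])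
      have hseg : ∀ w ∈ segment ℝ s0 s, 1 < w.re ∧ w.re ≤ 2 ∧ w.im = s.im := by
        intro w hw
        rw [segment_symm] at hw
        obtain ⟨u, v, hu, hv, huv, rfl⟩ := hw
        have hu' : u = 1 - v := by linarith
        subst hu'
        simp only [Complex.add_re, Complex.real_smul, Complex.re_ofReal_mul, Complex.add_im, Complex.im_ofReal_mul, hs0]
        refine ⟨?_, ?_, by ring⟩
        · nlinarith
        · nlinarith
      have hmv := (convex_segment (𝕜 := ℝ) s0 s).norm_image_sub_le_of_norm_hasDerivWithin_le (𝕜 := ℂ) (f := fun w => z * Lz w + Wz z w) (f' := fun w => z * deriv Lz w + deriv (Wz z) w) (C := C1 * q ^ 5)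
        (fun w hw => (((Lz_diff (hseg w hw).1).hasDerivAt.const_mul z).add (Wz_diffAt hz (hseg w hw).1.le).hasDerivAt).hasDerivWithinAt)
        (fun w hw => by
          obtain ⟨a1, a2, a3⟩ := hseg w hw
          have := hA z w hz a1 a2 (by rw [a3]; exact hy)
          rwa [a3] at this) (left_mem_segment ℝ s0 s) (right_mem_segment ℝ s0 s)
      have hdist : ‖s - s0‖ ≤ x0 := by
        have : s - s0 = ((s.re - (1 + x0) : ℝ) : ℂ) := by apply Complex.ext <;> simp [hs0]
        rw [this, Complex.norm_real, Real.norm_eq_abs, abs_of_neg (by linarith)]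
        linarith
      have h4 : ‖(z * Lz s + Wz z s) - (z * Lz s0 + Wz z s0)‖ ≤ C1 := by
        calc _ ≤ _ := hmv
          _ ≤ C1 * q ^ 5 * x0 := by gcongr
          _ = _ := by rw [hx0]; field_simp
      have h5 : FL z s = FL z s0 * Complex.exp ((z * Lz s + Wz z s) - (z * Lz s0 + Wz z s0)) := by
        rw [FL_eq_exp hz hs1, FL_eq_exp hz hs01, ← Complex.exp_add]
        congr 1; ring
      rw [h5, norm_mul, Complex.norm_exp]
      calc _ ≤ C * q ^ 5 * Real.exp C1 := by
            gcongr
            exact (Complex.re_le_norm _).trans h4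
        _ = _ := by ring
  refine ⟨Real.exp C1 * C * C1, by positivity, ?_⟩
  intro z s hz hs1 hs2 hy
  rw [(FL_hasDeriv hz hs1).deriv, norm_mul]
  have hq : (|s.im| ^ (1/40 : ℝ)) ^ 5 * (|s.im| ^ (1/40 : ℝ)) ^ 5 = |s.im| ^ (1/4 : ℝ) := by
    rw [← pow_add, ← Real.rpow_natCast, ← Real.rpow_mul (abs_nonneg _)]
    norm_num
  calc _ ≤ (Real.exp C1 * C * (|s.im| ^ (1/40 : ℝ)) ^ 5) * (C1 * (|s.im| ^ (1/40 : ℝ)) ^ 5) := by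
        gcongr
        · exact hF z s hz hs1 hs2 hy
        · exact hA z s hz hs1 hs2 hy
    _ = Real.exp C1 * C * C1 * ((|s.im| ^ (1/40 : ℝ)) ^ 5 * (|s.im| ^ (1/40 : ℝ)) ^ 5) := by ring
    _ = _ := by rw [hq]

lemma Lz_im {x : ℝ} (hx : 1 < x) : (Lz x).im = 0 := by
  have h : ∀ p : Nat.Primes, -Complex.log (1 - (p : ℂ) ^ (-(x:ℂ))) = ((-Real.log (1 - (p:ℝ) ^ (-x)) : ℝ) : ℂ) := by
    intro p
    have h1 := norm_prime_le_half (s := (x:ℂ)) (by simpa using hx.le) p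
    rw [norm_prime_cpow] at h1
    simp only [Complex.ofReal_re] at h1
    rw [Complex.ofReal_neg, Complex.ofReal_log (by linarith)]
    push_cast
    rw [Complex.ofReal_cpow (by positivity)]
    simp
  unfold Lz
  simp_rw [h]
  rw [← Complex.ofReal_tsum]
  simp

def Kz (s : ℂ) : ℂ := Lz s + Complex.log (s - 1)

lemma sub_one_slit {s : ℂ} (hs : 1 < s.re) : s - 1 ∈ Complex.slitPlane := by
  left; simpa using hs

lemma ne_one_of_re {s : ℂ} (hs : 1 < s.re) : s ≠ 1 := fun h => by simp [h] at hs

lemma exp_Kz {s : ℂ} (hs : 1 < s.re) : Complex.exp (Kz s) = riemannZeta₁ s := by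
  have h0 : s - 1 ≠ 0 := sub_ne_zero.2 (ne_one_of_re hs)
  rw [Kz, Complex.exp_add, exp_Lz hs, Complex.exp_log h0, riemannZeta_eq_inv_sub_mul (ne_one_of_re hs)]
  field_simp

lemma zeta1_ne {s : ℂ} (hs : 1 ≤ s.re) : riemannZeta₁ s ≠ 0 := by
  by_cases h : s = 1
  · rw [h]; simp
  · intro h0
    have := riemannZeta_ne_zero_of_one_le_re hs
    rw [riemannZeta_eq_inv_sub_mul h, h0] at this
    simp at this

lemma Kz_hasDeriv {s : ℂ} (hs : 1 < s.re) : HasDerivAt Kz (deriv Lz s + (s - 1)⁻¹) s := by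
  have := ((hasDerivAt_id s).sub_const 1).clog (sub_one_slit hs)
  simp only [id, one_div] at this
  exact (Lz_diff hs).hasDerivAt.add this

lemma Kz_deriv_eq {s : ℂ} (hs : 1 < s.re) : deriv Lz s + (s - 1)⁻¹ = deriv riemannZeta₁ s / riemannZeta₁ s := by
  have hev : (fun w => Complex.exp (Kz w)) =ᶠ[nhds s] riemannZeta₁ := by
    filter_upwards [(isOpen_lt continuous_const Complex.continuous_re).mem_nhds hs] with w hw
    exact exp_Kz hw
  have h1 := hev.deriv_eq
  rw [(Kz_hasDeriv hs).cexp.deriv, exp_Kz hs] at h1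
  rw [← h1, mul_div_cancel_left₀]
  exact zeta1_ne hs.le

lemma Kz_bounds : ∃ M : ℝ, 0 ≤ M ∧ ∀ s : ℂ, 1 < s.re → s.re ≤ 2 → |s.im| ≤ 1 →
    ‖deriv Lz s + (s - 1)⁻¹‖ ≤ M ∧ ‖Kz s‖ ≤ M * ‖s - 1‖ := by
  have hK : IsCompact (Set.Icc (1:ℝ) 2 ×ℂ Set.Icc (-1:ℝ) 1) := isCompact_Icc.reProdIm isCompact_Icc
  obtain ⟨M, hM⟩ := hK.exists_bound_of_continuousOn (f := fun s => deriv riemannZeta₁ s / riemannZeta₁ s) (by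
    refine ContinuousOn.div ?_ differentiable_riemannZeta₁.continuous.continuousOn (fun s hs => zeta1_ne ?_)
    · have : ContDiff ℂ 1 riemannZeta₁ := differentiable_riemannZeta₁.contDiff
      exact (this.continuous_deriv le_rfl).continuousOn
    · exact hs.1.1)
  have hb : ∀ s : ℂ, 1 < s.re → s.re ≤ 2 → |s.im| ≤ 1 → ‖deriv Lz s + (s - 1)⁻¹‖ ≤ M := by
    intro s h1 h2 h3
    rw [Kz_deriv_eq h1]
    exact hM s ⟨⟨h1.le, h2⟩, abs_le.1 h3⟩
  have hM0 : 0 ≤ M := (norm_nonneg _).trans (hb (3/2) (by norm_num) (by norm_num) (by simp))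
  refine ⟨M, hM0, fun s h1 h2 h3 => ⟨hb s h1 h2 h3, ?_⟩⟩
  have hconv : Convex ℝ (Set.Ioc (1:ℝ) 2 ×ℂ Set.Icc (-1:ℝ) 1) := 
    ((convex_Ioc 1 2).linear_preimage Complex.reLm).inter ((convex_Icc (-1) 1).linear_preimage Complex.imLm)
  have hlip : ∀ x : ℝ, 1 < x → x < 2 → ‖Kz s‖ ≤ ‖Kz x‖ + M * ‖s - x‖ := by
    intro x hx1 hx2
    have := hconv.norm_image_sub_le_of_norm_hasDerivWithin_le (𝕜 := ℂ) (f := Kz) (f' := fun w => deriv Lz w + (w-1)⁻¹) (C := M)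
      (fun w hw => (Kz_hasDeriv hw.1.1).hasDerivWithinAt)
      (fun w hw => hb w hw.1.1 hw.1.2 (abs_le.2 hw.2)) (x := (x:ℂ)) (y := s)
      ⟨by simp [hx1, hx2.le], by simp⟩ ⟨⟨h1, h2⟩, abs_le.1 h3⟩
    have h5 := norm_le_norm_add_norm_sub' (Kz s) (Kz x)
    linarith
  have hKr : ∀ x : ℝ, 1 < x → ‖Kz x‖ = |Real.log ‖riemannZeta₁ x‖| := by
    intro x hx
    have him : (Kz x).im = 0 := by
      rw [Kz, Complex.add_im, Lz_im hx, ← Complex.ofReal_one, ← Complex.ofReal_sub, ← Complex.ofReal_log (by linarith)]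
      simp
    have : Kz x = ((Kz x).re : ℂ) := Complex.ext (by simp) (by simp [him])
    rw [← exp_Kz (by simpa using hx), Complex.norm_exp, Real.log_exp, this, Complex.norm_real]
    simp
  have ht : Filter.Tendsto (fun x : ℝ => |Real.log ‖riemannZeta₁ x‖| + M * ‖s - x‖) (nhdsWithin 1 (Set.Ioi 1)) (nhds (M * ‖s - 1‖)) := by
    have hc : ContinuousAt (fun x : ℝ => |Real.log ‖riemannZeta₁ x‖| + M * ‖s - x‖) 1 := by
      have h6 : ContinuousAt (fun x : ℝ => ‖riemannZeta₁ x‖) 1 :=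
        (differentiable_riemannZeta₁.continuous.comp Complex.continuous_ofReal).norm.continuousAt
      refine ((h6.log (by simp)).abs).add ?_
      fun_prop
    have := hc.tendsto.mono_left (nhdsWithin_le_nhds (s := Set.Ioi 1))
    simpa using this
  refine ge_of_tendsto ht ?_
  filter_upwards [Ioo_mem_nhdsGT (show (1:ℝ) < 2 by norm_num)] with x hx
  rw [← hKr x hx.1]
  exact hlip x hx.1 hx.2

def cz (z : ℂ) : ℂ := Complex.exp (Wz z 1)
def mz (z : ℂ) : ℂ := if 0 ≤ z.re then z * cz z else 0

lemma norm_cpow_bd {u w : ℂ} (hu : u ≠ 0) (hw : |w.im| ≤ 1) : ‖u ^ w‖ ≤ Real.exp π * ‖u‖ ^ w.re := by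
  rw [Complex.norm_cpow_of_ne_zero hu, div_eq_mul_inv, ← Real.exp_neg, mul_comm]
  gcongr
  have h1 : |Complex.arg u| ≤ π := Complex.abs_arg_le_pi u
  calc -(Complex.arg u * w.im) ≤ |Complex.arg u * w.im| := neg_le_abs _
    _ = |Complex.arg u| * |w.im| := abs_mul _ _
    _ ≤ π * 1 := by gcongr
    _ = π := by ring

lemma cz_norm {z : ℂ} (hz : ‖z‖ ≤ 1) : ‖cz z‖ ≤ Real.exp CW := by
  rw [cz, Complex.norm_exp]
  gcongr
  exact (Complex.re_le_norm _).trans (Wz_bound hz (by norm_num))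

lemma exp_sub_exp_le {a b : ℂ} {R : ℝ} (ha : ‖a‖ ≤ R) (hb : ‖b‖ ≤ R) : ‖Complex.exp a - Complex.exp b‖ ≤ Real.exp R * ‖a - b‖ := by
  refine (convex_closedBall (0:ℂ) R).norm_image_sub_le_of_norm_deriv_le (𝕜 := ℂ) (f := Complex.exp) (fun w _ => Complex.differentiableAt_exp) ?_ (by simpa using hb) (by simpa using ha)
  intro w hw
  rw [Complex.deriv_exp, Complex.norm_exp]
  gcongr
  exact (Complex.re_le_norm _).trans (by simpa using hw)

lemma mz_norm {z : ℂ} (hz : ‖z‖ ≤ 1) : ‖mz z‖ ≤ Real.exp CW := by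
  unfold mz
  split_ifs
  · rw [norm_mul]
    have := cz_norm hz
    have h2 : 0 ≤ ‖cz z‖ := norm_nonneg _
    nlinarith [norm_nonneg z]
  · simpa using (Real.exp_pos _).le

lemma FL_near : ∃ C : ℝ, 0 ≤ C ∧ ∀ z s : ℂ, ‖z‖ ≤ 1 → 1 < s.re → s.re ≤ 2 → |s.im| ≤ 1 →
    ‖-deriv (FL z) s - mz z * (s - 1) ^ (-z - 1)‖ ≤ C / ‖s - 1‖ := by
  obtain ⟨M, hM0, hM⟩ := Kz_bounds
  have hCW := CW_nonneg
  set R := 2 * M + CW with hR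
  set B := M + CW / (1/5) with hB
  have hB0 : 0 ≤ B := by positivity
  refine ⟨Real.exp π * 2 * (Real.exp R * (1 + 2 * B)) + Real.exp π * 2 * (Real.exp R * B + Real.exp R * B), by positivity, ?_⟩
  intro z s hz hs1 hs2 hy
  obtain ⟨hK1, hK2⟩ := hM s hs1 hs2 hy
  set u := s - 1 with hu
  have hu0 : u ≠ 0 := sub_ne_zero.2 (ne_one_of_re hs1)
  have hun : 0 < ‖u‖ := norm_pos_iff.2 hu0
  have hu2 : ‖u‖ ≤ 2 := by
    have := Complex.norm_le_abs_re_add_abs_im u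
    simp only [hu, Complex.sub_re, Complex.one_re, Complex.sub_im, Complex.one_im, sub_zero] at this
    rw [abs_of_pos (by linarith)] at this
    linarith
  set E := z * Kz s + Wz z s with hE
  set A := z * (deriv Lz s + u⁻¹) + deriv (Wz z) s with hA
  have hFL : FL z s = u ^ (-z) * Complex.exp E := by
    rw [FL_eq_exp hz hs1, Complex.cpow_def_of_ne_zero hu0, ← Complex.exp_add, hE, Kz, ← hu]
    congr 1; ring
  have hder : -deriv (FL z) s = u ^ (-z) * Complex.exp E * (z * u⁻¹ - A) := by
    rw [(FL_hasDeriv hz hs1).deriv, hFL, hA]; ring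
  have hzK : ‖z * Kz s‖ ≤ M * ‖u‖ := by
    rw [norm_mul]
    calc _ ≤ 1 * (M * ‖u‖) := by gcongr
      _ = _ := one_mul _
  have hWs := Wz_bound hz (show 3/4 ≤ s.re by linarith)
  have hER : ‖E‖ ≤ R := by
    refine (norm_add_le _ _).trans ?_
    have : M * ‖u‖ ≤ M * 2 := by gcongr
    rw [hR]; linarith
  have hW1 := Wz_bound hz (show 3/4 ≤ (1:ℂ).re by norm_num)
  have hWR : ‖Wz z 1‖ ≤ R := by rw [hR]; linarith
  have hexpE : ‖Complex.exp E‖ ≤ Real.exp R := by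
    rw [Complex.norm_exp]; gcongr; exact (Complex.re_le_norm _).trans hER
  have hAB : ‖A‖ ≤ B := by
    refine (norm_add_le _ _).trans ?_
    rw [norm_mul, hB]
    have := Wz_deriv_bound hz hs1.le
    have h2 : ‖z‖ * ‖deriv Lz s + u⁻¹‖ ≤ 1 * M := by gcongr
    linarith
  have hzim : |(-z).im| ≤ 1 := by
    rw [Complex.neg_im, abs_neg]; exact (Complex.abs_im_le_norm z).trans hz
  have hzre : |z.re| ≤ 1 := (Complex.abs_re_le_norm z).trans hz
  have hcp := norm_cpow_bd hu0 hzim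
  rw [Complex.neg_re] at hcp
  unfold mz
  split_ifs with hzs
  · -- nonnegative real part
    have h1 : ‖u‖ ^ (-z.re) ≤ 2 / ‖u‖ := by
      rw [le_div_iff₀ hun]
      calc ‖u‖ ^ (-z.re) * ‖u‖ = ‖u‖ ^ (1 - z.re) := by
            rw [sub_eq_neg_add, Real.rpow_add hun, Real.rpow_one]
        _ ≤ 2 ^ (1 - z.re) := by
            gcongr
            linarith [(abs_le.1 hzre).2]
        _ ≤ 2 ^ (1:ℝ) := by
            gcongr
            · norm_num
            · linarith
        _ = 2 := by simp
    have h2 : -deriv (FL z) s - z * cz z * u ^ (-z - 1) = u ^ (-z) * (z * ((Complex.exp E - cz z) / u) - Complex.exp E * A) := by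
      rw [hder, Complex.cpow_sub _ _ hu0, Complex.cpow_one]; field_simp; ring
    have h3 : ‖Complex.exp E - cz z‖ ≤ Real.exp R * (B * ‖u‖) := by
      refine (exp_sub_exp_le hER hWR).trans ?_
      gcongr
      have h4 := Wz_lip (s := s) (t := 1) hz hs1.le (by simp)
      calc _ = ‖z * Kz s + (Wz z s - Wz z 1)‖ := by rw [hE]; congr 1; ring
        _ ≤ M * ‖u‖ + CW / (1/5) * ‖u‖ := (norm_add_le _ _).trans (add_le_add hzK h4)
        _ = _ := by rw [hB]; ring
    have h4 : ‖z * ((Complex.exp E - cz z) / u)‖ ≤ Real.exp R * B := by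
      rw [norm_mul, norm_div]
      calc _ ≤ 1 * (Real.exp R * (B * ‖u‖) / ‖u‖) := by gcongr
        _ = _ := by field_simp
    have h5 : ‖Complex.exp E * A‖ ≤ Real.exp R * B := by rw [norm_mul]; gcongr
    rw [h2, norm_mul]
    calc _ ≤ (Real.exp π * (2 / ‖u‖)) * (Real.exp R * B + Real.exp R * B) := by
          gcongr
          · exact hcp.trans (by gcongr)
          · exact (norm_sub_le _ _).trans (by gcongr)
      _ = Real.exp π * 2 * (Real.exp R * B + Real.exp R * B) / ‖u‖ := by ring
      _ ≤ _ := by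
          gcongr
          have : 0 ≤ Real.exp π * 2 * (Real.exp R * (1 + 2 * B)) := by positivity
          linarith
  · push Not at hzs
    have h1 : ‖u‖ ^ (-z.re) ≤ 2 := by
      calc _ ≤ (2:ℝ) ^ (-z.re) := by
            gcongr
            linarith
        _ ≤ 2 ^ (1:ℝ) := by
            gcongr
            · norm_num
            · linarith [(abs_le.1 hzre).1]
        _ = 2 := by simp
    rw [zero_mul, sub_zero, hder, norm_mul, norm_mul]
    have h2 : ‖z * u⁻¹ - A‖ ≤ (1 + 2 * B) / ‖u‖ := by
      refine (norm_sub_le _ _).trans ?_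
      rw [norm_mul, norm_inv, add_div]
      have h3 : B ≤ 2 * B / ‖u‖ := by
        rw [le_div_iff₀ hun]; nlinarith
      have h4 : ‖z‖ * ‖u‖⁻¹ ≤ 1 / ‖u‖ := by
        rw [div_eq_mul_inv]; gcongr
      linarith
    calc _ ≤ Real.exp π * 2 * Real.exp R * ((1 + 2 * B) / ‖u‖) := by
          gcongr
          exact hcp.trans (by gcongr)
      _ = Real.exp π * 2 * (Real.exp R * (1 + 2 * B)) / ‖u‖ := by ring
      _ ≤ _ := by
          gcongr
          have : 0 ≤ Real.exp π * 2 * (Real.exp R * B + Real.exp R * B) := by positivity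
          linarith


lemma lemma_G : ∃ C : ℝ, 0 ≤ C ∧ ∀ z s : ℂ, ‖z‖ ≤ 1 → 1 < s.re → s.re ≤ 2 →
    ‖-deriv (FL z) s / s - mz z * (s - 1) ^ (-z - 1)‖ ^ 2 ≤
      C * (((s.re - 1) ^ 2 + s.im ^ 2)⁻¹ + (1 + s.im ^ 2) ^ (-(3/4) : ℝ)) := by
  obtain ⟨C1, hC1, hnear⟩ := FL_near
  obtain ⟨C2, hC2, hfar⟩ := FL_far
  set D := Real.exp CW * Real.exp π with hD
  have hD0 : 0 < D := by positivity
  refine ⟨(C1 + 3 * D) ^ 2 + 2 * C2 ^ 2 * 2 + 2 * D ^ 2, by positivity, ?_⟩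
  intro z s hz hs1 hs2
  set u := s - 1 with hu
  have hu0 : u ≠ 0 := sub_ne_zero.2 (ne_one_of_re hs1)
  have hun : 0 < ‖u‖ := norm_pos_iff.2 hu0
  have husq : ‖u‖ ^ 2 = (s.re - 1) ^ 2 + s.im ^ 2 := by
    rw [← Complex.normSq_eq_norm_sq, Complex.normSq_apply]; simp [hu]; ring
  rw [← husq]
  have hs0 : s ≠ 0 := fun h => by rw [h] at hs1; simp at hs1; linarith
  have hsn : 1 ≤ ‖s‖ := by linarith [Complex.re_le_norm s]
  have hzim : |z.im| ≤ 1 := (Complex.abs_im_le_norm z).trans hz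
  have hzre : |z.re| ≤ 1 := (Complex.abs_re_le_norm z).trans hz
  have hpow0 : 0 ≤ (1 + s.im ^ 2) ^ (-(3/4) : ℝ) := by positivity
  have hinv0 : 0 ≤ (‖u‖ ^ 2)⁻¹ := by positivity
  rcases le_total |s.im| 1 with hy | hy
  · have h1 := hnear z s hz hs1 hs2 hy
    have hu2 : ‖u‖ ≤ 2 := by
      have := Complex.norm_le_abs_re_add_abs_im u
      simp only [hu, Complex.sub_re, Complex.one_re, Complex.sub_im, Complex.one_im, sub_zero] at this
      rw [abs_of_pos (by linarith)] at this
      linarith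
    have h2 : ‖mz z * u ^ (-z)‖ ≤ 2 * D / ‖u‖ := by
      by_cases hzs : 0 ≤ z.re
      · have h3 := norm_cpow_bd (w := -z) hu0 (by simpa using hzim)
        rw [Complex.neg_re] at h3
        have h4 : ‖u‖ ^ (-z.re) ≤ 2 / ‖u‖ := by
          rw [le_div_iff₀ hun]
          calc ‖u‖ ^ (-z.re) * ‖u‖ = ‖u‖ ^ (1 - z.re) := by
                rw [sub_eq_neg_add, Real.rpow_add hun, Real.rpow_one]
            _ ≤ 2 ^ (1 - z.re) := by
                gcongr
                linarith [(abs_le.1 hzre).2]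
            _ ≤ 2 ^ (1:ℝ) := by
                gcongr
                · norm_num
                · linarith
            _ = 2 := by simp
        rw [norm_mul]
        calc _ ≤ Real.exp CW * (Real.exp π * (2 / ‖u‖)) := by
              gcongr
              · exact mz_norm hz
              · exact h3.trans (by gcongr)
          _ = _ := by rw [hD]; ring
      · rw [mz, if_neg hzs]
        simp
        positivity
    have h3 : -deriv (FL z) s / s - mz z * u ^ (-z - 1) =
        (-deriv (FL z) s - mz z * u ^ (-z - 1)) / s - mz z * u ^ (-z) / s := by
      rw [Complex.cpow_sub _ _ hu0, Complex.cpow_one]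
      field_simp
      rw [hu]; ring
    have h4 : ‖-deriv (FL z) s / s - mz z * u ^ (-z - 1)‖ ≤ (C1 + 3 * D) / ‖u‖ := by
      rw [h3]
      refine (norm_sub_le _ _).trans ?_
      rw [norm_div, norm_div]
      calc _ ≤ C1 / ‖u‖ + 2 * D / ‖u‖ := by
            exact add_le_add ((div_le_self (norm_nonneg _) hsn).trans h1)
              ((div_le_self (norm_nonneg _) hsn).trans h2)
        _ ≤ _ := by
            rw [← add_div]; gcongr; linarith
    calc _ ≤ ((C1 + 3 * D) / ‖u‖) ^ 2 := by gcongr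
      _ = (C1 + 3 * D) ^ 2 * (‖u‖ ^ 2)⁻¹ := by rw [div_pow]; ring
      _ ≤ _ := by gcongr <;> nlinarith
  · have h1 := hfar z s hz hs1 hs2 hy
    have hus : |s.im| ≤ ‖u‖ := by
      have := Complex.abs_im_le_norm u
      simpa [hu] using this
    have hu1 : 1 ≤ ‖u‖ := hy.trans hus
    have h2 : ‖mz z * u ^ (-z - 1)‖ ≤ D / ‖u‖ := by
      by_cases hzs : 0 ≤ z.re
      · have h3 := norm_cpow_bd (w := -z - 1) hu0 (by simpa using hzim)
        have h4 : ‖u‖ ^ (-z - 1).re ≤ 1 / ‖u‖ := by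
          calc _ ≤ ‖u‖ ^ (-1 : ℝ) := by
                gcongr
                simp; linarith
            _ = _ := by rw [Real.rpow_neg_one, one_div]
        rw [norm_mul]
        calc _ ≤ Real.exp CW * (Real.exp π * (1 / ‖u‖)) := by
              gcongr
              · exact mz_norm hz
              · exact h3.trans (by gcongr)
          _ = _ := by rw [hD]; ring
      · rw [mz, if_neg hzs]
        simp
        positivity
    have hsy : |s.im| ≤ ‖s‖ := Complex.abs_im_le_norm s
    have hy0 : 0 < |s.im| := by linarith
    have h3 : ‖-deriv (FL z) s / s‖ ^ 2 ≤ C2 ^ 2 * 2 * (1 + s.im ^ 2) ^ (-(3/4) : ℝ) := by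
      rw [norm_div, norm_neg]
      calc _ ≤ (C2 * |s.im| ^ (1/4 : ℝ) / |s.im|) ^ 2 := by gcongr
        _ = C2 ^ 2 * (|s.im| ^ (-(3/4) : ℝ)) ^ 2 := by
            rw [mul_div_assoc, mul_pow]
            congr 2
            rw [← Real.rpow_sub_one hy0.ne']; norm_num
        _ = C2 ^ 2 * (s.im ^ 2) ^ (-(3/4) : ℝ) := by
            congr 1
            rw [← sq_abs s.im, ← Real.rpow_natCast, ← Real.rpow_natCast, ← Real.rpow_mul hy0.le, ← Real.rpow_mul hy0.le]
            norm_num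
        _ ≤ C2 ^ 2 * (2 * (1 + s.im ^ 2) ^ (-(3/4) : ℝ)) := by
            gcongr
            have hsq : 1 ≤ s.im ^ 2 := by rw [← sq_abs]; exact one_le_pow₀ hy
            have e1 : (s.im ^ 2) ^ (-(3/4) : ℝ) ≤ ((1 + s.im ^ 2) / 2) ^ (-(3/4) : ℝ) :=
              Real.rpow_le_rpow_of_nonpos (by positivity) (by linarith) (by norm_num)
            refine e1.trans ?_
            rw [Real.div_rpow (by positivity) (by norm_num), div_eq_mul_inv, ← Real.rpow_neg (by norm_num), mul_comm]
            gcongr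
            calc (2:ℝ) ^ (- -(3/4) : ℝ) ≤ 2 ^ (1:ℝ) := by
                  gcongr
                  · norm_num
                  · norm_num
              _ = 2 := by simp
        _ = _ := by ring
    have h4 : ‖mz z * u ^ (-z - 1)‖ ^ 2 ≤ D ^ 2 * (‖u‖ ^ 2)⁻¹ := by
      calc _ ≤ (D / ‖u‖) ^ 2 := by gcongr
        _ = _ := by rw [div_pow]; ring
    have h5 : ‖-deriv (FL z) s / s - mz z * u ^ (-z - 1)‖ ^ 2 ≤ 2 * ‖-deriv (FL z) s / s‖ ^ 2 + 2 * ‖mz z * u ^ (-z - 1)‖ ^ 2 := by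
      have := norm_sub_le (-deriv (FL z) s / s) (mz z * u ^ (-z - 1))
      have h6 := pow_le_pow_left₀ (norm_nonneg _) this 2
      nlinarith [sq_nonneg (‖-deriv (FL z) s / s‖ - ‖mz z * u ^ (-z - 1)‖)]
    have e1 : 0 ≤ (C1 + 3 * D) ^ 2 * ((‖u‖ ^ 2)⁻¹ + (1 + s.im ^ 2) ^ (-(3/4) : ℝ)) := by positivity
    have e2 : 0 ≤ 2 * C2 ^ 2 * 2 * (‖u‖ ^ 2)⁻¹ := by positivity
    have e3 : 0 ≤ 2 * D ^ 2 * (1 + s.im ^ 2) ^ (-(3/4) : ℝ) := by positivity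
    linarith

open MeasureTheory in
lemma integrableOn_rpow_exp {a b : ℝ} (ha : -1 < a) (hb : 0 < b) :
    IntegrableOn (fun t : ℝ => t ^ a * Real.exp (-b * t)) (Set.Ioi 0) := by
  have := integrableOn_rpow_mul_exp_neg_mul_rpow (p := 1) (s := a) (b := b) ha one_pos hb
  simpa using this

lemma norm_cpow_exp {t : ℝ} (ht : 0 < t) (c r : ℂ) :
    ‖(t:ℂ) ^ c * Complex.exp (-(r * t))‖ = t ^ c.re * Real.exp (-r.re * t) := by
  rw [norm_mul, Complex.norm_cpow_eq_rpow_re_of_pos ht, Complex.norm_exp]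
  simp

open MeasureTheory in
lemma measurable_cpow_exp (c r : ℂ) : Measurable (fun t : ℝ => (t:ℂ) ^ c * Complex.exp (-(r * t))) := by
  fun_prop

open MeasureTheory in
lemma integrable_cpow_exp {c r : ℂ} (hc : -1 < c.re) (hr : 0 < r.re) :
    IntegrableOn (fun t : ℝ => (t:ℂ) ^ c * Complex.exp (-(r * t))) (Set.Ioi 0) := by
  refine Integrable.mono' (integrableOn_rpow_exp hc hr) (measurable_cpow_exp c r).aestronglyMeasurable ?_
  filter_upwards [ae_restrict_mem measurableSet_Ioi] with t ht
  rw [norm_cpow_exp ht]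

open MeasureTheory in
lemma gamma_int {a r : ℂ} (ha : 0 < a.re) (hr : 0 < r.re) :
    ∫ t : ℝ in Set.Ioi 0, (t:ℂ) ^ (a - 1) * Complex.exp (-(r * t)) = r ^ (-a) * Complex.Gamma a := by
  have hopen : IsOpen {w : ℂ | 0 < w.re} := isOpen_lt continuous_const Complex.continuous_re
  set J : ℂ → ℂ := fun r => ∫ t : ℝ in Set.Ioi 0, (t:ℂ) ^ (a - 1) * Complex.exp (-(r * t)) with hJ
  have hJd : DifferentiableOn ℂ J {w : ℂ | 0 < w.re} := by
    intro w hw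
    have hw' : 0 < w.re := hw
    refine DifferentiableAt.differentiableWithinAt ?_
    have := hasDerivAt_integral_of_dominated_loc_of_deriv_le (𝕜 := ℂ) (μ := volume.restrict (Set.Ioi (0:ℝ)))
      (F := fun r t => (t:ℂ) ^ (a - 1) * Complex.exp (-(r * t)))
      (F' := fun r t => (t:ℂ) ^ (a - 1) * (Complex.exp (-(r * t)) * -(t:ℂ)))
      (x₀ := w) (s := Metric.ball w (w.re/2)) (bound := fun t => t ^ a.re * Real.exp (-(w.re/2) * t))
      (Metric.ball_mem_nhds w (by linarith))
      (Filter.Eventually.of_forall fun r => (measurable_cpow_exp (a-1) r).aestronglyMeasurable)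
      (integrable_cpow_exp (by simpa using ha) hw')
      (by
        refine Measurable.aestronglyMeasurable ?_
        fun_prop)
      (by
        filter_upwards [ae_restrict_mem measurableSet_Ioi] with t ht r hr
        have ht' : 0 < t := ht
        have hre : w.re / 2 ≤ r.re := by
          rw [Metric.mem_ball, dist_eq_norm] at hr
          have := (Complex.abs_re_le_norm (r - w)).trans_lt hr
          rw [Complex.sub_re, abs_lt] at this
          linarith [this.1]
        rw [← mul_assoc, norm_mul, norm_cpow_exp ht', norm_neg, Complex.norm_real, Real.norm_of_nonneg ht'.le]
        simp only [Complex.sub_re, Complex.one_re]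
        rw [Real.rpow_sub_one ht'.ne']
        calc t ^ a.re / t * Real.exp (-r.re * t) * t = t ^ a.re * Real.exp (-r.re * t) := by field_simp
          _ ≤ _ := by gcongr)
      (integrableOn_rpow_exp (by linarith) (by linarith))
      (by
        refine Filter.Eventually.of_forall fun t r _ => ?_
        refine HasDerivAt.const_mul _ ?_
        refine HasDerivAt.cexp ?_
        exact ((hasDerivAt_id r).mul_const (t:ℂ)).neg.congr_deriv (by simp))
    exact this.2.differentiableAt
  have hPd : DifferentiableOn ℂ (fun r : ℂ => r ^ (-a) * Complex.Gamma a) {w : ℂ | 0 < w.re} := by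
    intro w hw
    refine DifferentiableAt.differentiableWithinAt ?_
    exact (differentiableAt_id.cpow_const (Or.inl hw)).mul_const _
  have hpre : IsPreconnected {w : ℂ | 0 < w.re} := (convex_halfSpace_re_gt 0).isPreconnected
  have hreal : ∀ x : ℝ, 0 < x → J x = (x:ℂ) ^ (-a) * Complex.Gamma a := by
    intro x hx
    have := Complex.integral_cpow_mul_exp_neg_mul_Ioi ha hx
    rw [hJ]
    simp only
    rw [this, one_div, Complex.inv_cpow, Complex.cpow_neg]
    rw [Complex.arg_ofReal_of_nonneg hx.le]
    exact Real.pi_pos.ne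
  have := (hJd.analyticOnNhd hopen).eqOn_of_preconnected_of_frequently_eq (hPd.analyticOnNhd hopen) hpre (z₀ := 1) (by simp) ?_
  · exact this hr
  · have ht : Filter.Tendsto (fun n : ℕ => ((1 + 1 / ((n:ℝ) + 1) : ℝ) : ℂ)) Filter.atTop (nhdsWithin 1 {1}ᶜ) := by
      rw [tendsto_nhdsWithin_iff]
      constructor
      · have : Filter.Tendsto (fun n : ℕ => (1 + 1 / ((n:ℝ) + 1) : ℝ)) Filter.atTop (nhds (1 + 0)) :=
          tendsto_one_div_add_atTop_nhds_zero_nat.const_add 1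
        have h2 := (Complex.continuous_ofReal.tendsto _).comp this
        simpa [Function.comp_def] using h2
      · refine Filter.Eventually.of_forall fun n => ?_
        have : (0:ℝ) < 1 / ((n:ℝ) + 1) := by positivity
        simp only [Set.mem_compl_iff, Set.mem_singleton_iff]
        intro h
        have h3 : (1 + 1 / ((n:ℝ) + 1) : ℝ) = 1 := by exact_mod_cast h
        linarith
    refine ht.frequently (Filter.Frequently.of_forall fun n => hreal _ (by positivity))

def S1 (z : ℂ) (x : ℝ) : ℂ := ∑ k ∈ Finset.Icc 1 ⌊x⌋₊, LSeries.logMul (fun n => z ^ bigOmega n) k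

lemma logMul_norm {z : ℂ} (hz : ‖z‖ ≤ 1) {k : ℕ} : ‖LSeries.logMul (fun n => z ^ bigOmega n) k‖ ≤ Real.log k := by
  unfold LSeries.logMul
  rw [norm_mul]
  have h1 : ‖Complex.log (k:ℂ)‖ = Real.log k := by
    rw [← Complex.natCast_log, Complex.norm_real, Real.norm_of_nonneg (Real.log_natCast_nonneg k)]
  rw [h1]
  exact mul_le_of_le_one_right (Real.log_natCast_nonneg k) (norm_zpow_le hz k)

lemma S1_bound {z : ℂ} (hz : ‖z‖ ≤ 1) {x : ℝ} (hx : 1 ≤ x) : ‖S1 z x‖ ≤ x * Real.log x := by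
  have hf : (⌊x⌋₊ : ℝ) ≤ x := Nat.floor_le (by linarith)
  calc ‖S1 z x‖ ≤ ∑ k ∈ Finset.Icc 1 ⌊x⌋₊, Real.log x := by
        refine norm_sum_le_of_le _ fun k hk => (logMul_norm hz).trans ?_
        rw [Finset.mem_Icc] at hk
        refine Real.log_le_log (by exact_mod_cast hk.1) ?_
        exact (by exact_mod_cast hk.2 : (k:ℝ) ≤ ⌊x⌋₊).trans hf
    _ = ⌊x⌋₊ * Real.log x := by simp
    _ ≤ _ := by
        have := Real.log_nonneg hx
        gcongr

open MeasureTheory in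
lemma FL_deriv_int {z s : ℂ} (hz : ‖z‖ ≤ 1) (hs : 1 < s.re) :
    -deriv (FL z) s / s = ∫ v : ℝ in Set.Ioi 0, S1 z (Real.exp v) * Complex.exp (-(s * v)) := by
  have hs0 : s ≠ 0 := fun h => by rw [h] at hs; simp at hs; linarith
  have h1 : deriv (FL z) s = - LSeries (LSeries.logMul (fun n => z ^ bigOmega n)) s :=
    LSeries_deriv (FL_absc_lt hz hs)
  set r := (1 + s.re) / 2 with hr
  have hr1 : 1 < r := by simp [hr]; linarith
  have hO : (fun n => ∑ k ∈ Finset.Icc 1 n, LSeries.logMul (fun n => z ^ bigOmega n) k) =O[Filter.atTop] fun n : ℕ => (n:ℝ) ^ r := by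
    refine Asymptotics.IsBigO.of_bound (1 / (r - 1)) ?_
    filter_upwards [Filter.eventually_ge_atTop 1] with n hn
    have hn' : (1:ℝ) ≤ n := by exact_mod_cast hn
    have := S1_bound hz hn'
    rw [S1, Nat.floor_natCast] at this
    refine this.trans ?_
    rw [Real.norm_of_nonneg (by positivity)]
    have h2 := Real.log_le_rpow_div (x := n) (by positivity) (ε := r - 1) (by linarith)
    calc (n:ℝ) * Real.log n ≤ n * ((n:ℝ) ^ (r-1) / (r-1)) := by gcongr
      _ = 1 / (r-1) * (n ^ (r-1) * n) := by ring
      _ = _ := by rw [← Real.rpow_add_one (by positivity)]; simp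
  have h2 := LSeries_eq_mul_integral (LSeries.logMul (fun n => z ^ bigOmega n)) (r := r) (by linarith) (s := s) (by simp [hr]; linarith)
    (LSeriesSummable_logMul_of_lt_re (FL_absc_lt hz hs)) hO
  rw [h1, h2, neg_neg, mul_div_cancel_left₀ _ hs0]
  have himg : Real.exp '' Set.Ioi 0 = Set.Ioi 1 := by
    ext x
    simp only [Set.mem_image, Set.mem_Ioi]
    constructor
    · rintro ⟨y, hy, rfl⟩
      exact Real.one_lt_exp_iff.2 hy
    · intro hx
      exact ⟨Real.log x, Real.log_pos hx, Real.exp_log (by linarith)⟩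
  rw [← himg, integral_image_eq_integral_abs_deriv_smul measurableSet_Ioi (fun x _ => (Real.hasDerivAt_exp x).hasDerivWithinAt) Real.exp_injective.injOn]
  refine setIntegral_congr_fun measurableSet_Ioi fun v _ => ?_
  simp only [abs_of_pos (Real.exp_pos v), Complex.real_smul]
  rw [Complex.ofReal_exp, ← Complex.exp_log (Complex.exp_ne_zero (v:ℂ))] 
  have hlog : Complex.log (Complex.exp (v:ℂ)) = v := by
    rw [← Complex.ofReal_exp, ← Complex.ofReal_log (Real.exp_pos v).le, Real.log_exp]
  rw [hlog, Complex.cpow_def_of_ne_zero (Complex.exp_ne_zero _), hlog, S1, mul_left_comm, ← Complex.exp_add]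
  congr 2
  ring

def mm (z : ℂ) : ℂ := mz z / Complex.Gamma (z + 1)
def hh (z : ℂ) (v : ℝ) : ℂ := Complex.exp (-v) * S1 z (Real.exp v) - mm z * (v:ℂ) ^ z
def gg (z : ℂ) (η : ℝ) : ℝ → ℂ := Set.indicator (Set.Ioi 0) (fun v => hh z v * Complex.exp (-(η * v)))

lemma mm_bound : ∃ D : ℝ, 0 ≤ D ∧ ∀ z : ℂ, ‖z‖ ≤ 1 → ‖mm z‖ ≤ D := by
  obtain ⟨M, hM⟩ := (isCompact_closedBall (0:ℂ) 1).exists_bound_of_continuousOn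
    (f := fun z => (Complex.Gamma (z + 1))⁻¹) (Complex.differentiable_one_div_Gamma.continuous.comp (continuous_id.add continuous_const)).continuousOn
  have hM0 : 0 ≤ M := (norm_nonneg _).trans (hM 0 (by simp))
  refine ⟨Real.exp CW * M, by positivity, fun z hz => ?_⟩
  rw [mm, div_eq_mul_inv, norm_mul]
  gcongr
  · exact mz_norm hz
  · exact hM z (by simpa using hz)

lemma mm_of_neg {z : ℂ} (h : ¬ 0 ≤ z.re) : mm z = 0 := by simp [mm, mz, h]

lemma expS1_norm {z : ℂ} (hz : ‖z‖ ≤ 1) {v : ℝ} (hv : 0 ≤ v) : ‖Complex.exp (-v) * S1 z (Real.exp v)‖ ≤ v := by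
  rw [norm_mul, Complex.norm_exp]
  have := S1_bound hz (Real.one_le_exp hv)
  rw [Real.log_exp] at this
  simp only [Complex.neg_re, Complex.ofReal_re]
  calc _ ≤ Real.exp (-v) * (Real.exp v * v) := by gcongr
    _ = v := by rw [← mul_assoc, ← Real.exp_add]; simp

lemma mmcpow_norm {z : ℂ} (hz : ‖z‖ ≤ 1) {D : ℝ} (hD0 : 0 ≤ D) (hD : ∀ z : ℂ, ‖z‖ ≤ 1 → ‖mm z‖ ≤ D) {v : ℝ} (hv : 0 < v) :
    ‖mm z * (v:ℂ) ^ z‖ ≤ D * (1 + v) := by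
  by_cases h : 0 ≤ z.re
  · rw [norm_mul, Complex.norm_cpow_eq_rpow_re_of_pos hv]
    have h1 : z.re ≤ 1 := (Complex.re_le_norm z).trans hz
    gcongr
    · exact hD z hz
    · rcases le_total v 1 with h2 | h2
      · have := Real.rpow_le_one hv.le h2 h
        linarith
      · have := Real.rpow_le_rpow_of_exponent_le h2 h1
        rw [Real.rpow_one] at this
        linarith
  · rw [mm_of_neg h]; simp; positivity

lemma hh_norm {z : ℂ} (hz : ‖z‖ ≤ 1) {D : ℝ} (hD0 : 0 ≤ D) (hD : ∀ z : ℂ, ‖z‖ ≤ 1 → ‖mm z‖ ≤ D) {v : ℝ} (hv : 0 < v) :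
    ‖hh z v‖ ≤ (1 + D) * (1 + v) := by
  have h1 := expS1_norm hz hv.le
  have h2 := mmcpow_norm hz hD0 hD hv
  refine (norm_sub_le _ _).trans ?_
  linarith

lemma measurable_S1 (z : ℂ) : Measurable (fun v : ℝ => S1 z (Real.exp v)) := by
  have h1 : Measurable (fun v : ℝ => ⌊Real.exp v⌋₊) := Nat.measurable_floor.comp Real.measurable_exp
  exact (measurable_from_nat (f := fun n => ∑ k ∈ Finset.Icc 1 n, LSeries.logMul (fun n => z ^ bigOmega n) k)).comp h1

lemma measurable_hh (z : ℂ) : Measurable (hh z) := by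
  have := measurable_S1 z
  unfold hh
  fun_prop

lemma measurable_gg (z : ℂ) (η : ℝ) : Measurable (gg z η) := by
  have := measurable_hh z
  unfold gg
  refine Measurable.indicator ?_ measurableSet_Ioi
  fun_prop

lemma gg_norm {z : ℂ} (hz : ‖z‖ ≤ 1) {η : ℝ} (hη : 0 < η) : ∃ K : ℝ, 0 ≤ K ∧ ∀ v, ‖gg z η v‖ ≤
    Set.indicator (Set.Ioi 0) (fun v => K * Real.exp (-(η/2) * v)) v := by
  obtain ⟨D, hD0, hD⟩ := mm_bound
  refine ⟨(1 + D) * (1 + 2 / η), by positivity, fun v => ?_⟩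
  unfold gg
  by_cases hv : v ∈ Set.Ioi (0:ℝ)
  · rw [Set.indicator_of_mem hv, Set.indicator_of_mem hv]
    have hv' : 0 < v := hv
    rw [norm_mul, Complex.norm_exp]
    have h1 := hh_norm hz hD0 hD hv'
    have h2 : (1 + v) ≤ (1 + 2 / η) * Real.exp (η / 2 * v) := by
      have h3 := Real.add_one_le_exp (η / 2 * v)
      calc 1 + v ≤ (1 + 2 / η) * (η / 2 * v + 1) := by
            have : (1 + 2 / η) * (η / 2 * v + 1) = η / 2 * v + v + 1 + 2 / η := by field_simp; ring
            rw [this]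
            have : 0 ≤ η / 2 * v := by positivity
            have : 0 ≤ 2 / η := by positivity
            linarith
        _ ≤ _ := by gcongr
    have h4 : (-((η:ℂ) * (v:ℂ))).re = -(η * v) := by simp
    rw [h4]
    calc _ ≤ (1 + D) * ((1 + 2 / η) * Real.exp (η / 2 * v)) * Real.exp (-(η * v)) := by
          gcongr
          exact h1.trans (by gcongr)
      _ = (1 + D) * (1 + 2 / η) * (Real.exp (η / 2 * v) * Real.exp (-(η * v))) := by ring
      _ = _ := by rw [← Real.exp_add]; congr 2; ring
  · rw [Set.indicator_of_notMem hv, Set.indicator_of_notMem hv]; simp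

open MeasureTheory in
lemma gg_integrable {z : ℂ} (hz : ‖z‖ ≤ 1) {η : ℝ} (hη : 0 < η) : Integrable (gg z η) := by
  obtain ⟨K, hK, h⟩ := gg_norm hz hη
  refine Integrable.mono' ?_ (measurable_gg z η).aestronglyMeasurable (Filter.Eventually.of_forall h)
  rw [integrable_indicator_iff measurableSet_Ioi]
  exact (exp_neg_integrableOn_Ioi 0 (by linarith)).const_mul K

open MeasureTheory in
lemma gg_memLp {z : ℂ} (hz : ‖z‖ ≤ 1) {η : ℝ} (hη : 0 < η) : MemLp (gg z η) 2 := by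
  obtain ⟨K, hK, h⟩ := gg_norm hz hη
  rw [memLp_two_iff_integrable_sq_norm (measurable_gg z η).aestronglyMeasurable]
  have hi : Integrable (Set.indicator (Set.Ioi (0:ℝ)) (fun v => K ^ 2 * Real.exp (-η * v))) := by
    rw [integrable_indicator_iff measurableSet_Ioi]
    exact (exp_neg_integrableOn_Ioi 0 hη).const_mul _
  refine Integrable.mono' hi ((measurable_gg z η).norm.pow_const 2).aestronglyMeasurable (Filter.Eventually.of_forall fun v => ?_)
  have h1 := pow_le_pow_left₀ (norm_nonneg _) (h v) 2
  rw [Real.norm_of_nonneg (by positivity)]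
  refine h1.trans (le_of_eq ?_)
  by_cases hv : v ∈ Set.Ioi (0:ℝ)
  · rw [Set.indicator_of_mem hv, Set.indicator_of_mem hv, mul_pow, ← Real.exp_nat_mul]
    congr 2
    push_cast; ring
  · rw [Set.indicator_of_notMem hv, Set.indicator_of_notMem hv]; simp

open MeasureTheory in
lemma S1_integrable {z s : ℂ} (hz : ‖z‖ ≤ 1) (hs : 1 < s.re) :
    IntegrableOn (fun v : ℝ => S1 z (Real.exp v) * Complex.exp (-(s * v))) (Set.Ioi 0) := by
  have h0 := integrableOn_rpow_exp (a := 1) (b := s.re - 1) (by norm_num) (by linarith)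
  refine Integrable.mono' h0 ?_ ?_
  · have := measurable_S1 z
    refine Measurable.aestronglyMeasurable ?_
    fun_prop
  · filter_upwards [ae_restrict_mem measurableSet_Ioi] with v hv
    have hv' : 0 < v := hv
    rw [norm_mul, Complex.norm_exp]
    have := S1_bound hz (Real.one_le_exp hv'.le)
    rw [Real.log_exp] at this
    have h2 : (-(s * v)).re = -(s.re * v) := by simp
    rw [h2, Real.rpow_one]
    calc _ ≤ (Real.exp v * v) * Real.exp (-(s.re * v)) := by gcongr
      _ = v * (Real.exp v * Real.exp (-(s.re * v))) := by ring
      _ = _ := by rw [← Real.exp_add]; congr 2; ring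

open MeasureTheory FourierTransform in
lemma gg_fourier {z : ℂ} (hz : ‖z‖ ≤ 1) {η : ℝ} (hη : 0 < η) (ξ : ℝ) :
    𝓕 (gg z η) ξ = -deriv (FL z) ⟨1 + η, 2 * π * ξ⟩ / ⟨1 + η, 2 * π * ξ⟩ -
      mz z * ((⟨1 + η, 2 * π * ξ⟩ : ℂ) - 1) ^ (-z - 1) := by
  set s : ℂ := ⟨1 + η, 2 * π * ξ⟩ with hs
  have hs1 : 1 < s.re := by simp [hs, hη]
  have hse : s = 1 + η + 2 * π * ξ * Complex.I := by
    apply Complex.ext <;> simp [hs]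
  rw [FL_deriv_int hz hs1, Real.fourier_real_eq_integral_exp_smul]
  have h1 : ∀ v : ℝ, Complex.exp (↑(-2 * π * v * ξ) * Complex.I) • gg z η v =
      Set.indicator (Set.Ioi 0) (fun v : ℝ => S1 z (Real.exp v) * Complex.exp (-(s * v)) - mm z * ((v:ℂ) ^ z * Complex.exp (-((s - 1) * v)))) v := by
    intro v
    unfold gg
    by_cases hv : v ∈ Set.Ioi (0:ℝ)
    · rw [Set.indicator_of_mem hv, Set.indicator_of_mem hv, hh, smul_eq_mul]
      have e1 : Complex.exp (-(s * v)) = Complex.exp (-v) * (Complex.exp (-(η * v)) * Complex.exp (↑(-2 * π * v * ξ) * Complex.I)) := by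
        rw [← Complex.exp_add, ← Complex.exp_add, hse]
        congr 1; push_cast; ring
      have e2 : Complex.exp (-((s-1) * v)) = (Complex.exp (-(η * v)) * Complex.exp (↑(-2 * π * v * ξ) * Complex.I)) := by
        rw [← Complex.exp_add, hse]
        congr 1; push_cast; ring
      rw [e1, e2]; ring
    · rw [Set.indicator_of_notMem hv, Set.indicator_of_notMem hv, smul_zero]
  simp_rw [h1]
  rw [integral_indicator measurableSet_Ioi]
  have hsr : 0 < (s - 1).re := by simp [hs, hη]
  by_cases hzs : 0 ≤ z.re
  · rw [integral_sub (S1_integrable hz hs1) ((integrable_cpow_exp (by linarith) hsr).const_mul _), integral_const_mul]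
    congr 1
    have := gamma_int (a := z + 1) (r := s - 1) (by simp; linarith) hsr
    rw [add_sub_cancel_right] at this
    rw [this, mm]
    have hG : Complex.Gamma (z + 1) ≠ 0 := Complex.Gamma_ne_zero_of_re_pos (by simp; linarith)
    rw [show -z - 1 = -(z+1) by ring]
    field_simp
  · rw [mm_of_neg hzs]
    simp [mz, hzs]

open MeasureTheory FourierTransform in
lemma fourier_cont {g : ℝ → ℂ} (hg : Integrable g) : Continuous (𝓕 g) :=
  VectorFourier.fourierIntegral_continuous Real.continuous_fourierChar (by fun_prop) hg

open MeasureTheory in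
lemma L2_bound : ∃ C : ℝ, 0 ≤ C ∧ ∀ (z : ℂ) (η : ℝ), ‖z‖ ≤ 1 → 0 < η → η ≤ 1 →
    ∫ v, ‖gg z η v‖ ^ 2 ≤ C / η := by
  obtain ⟨C, hC, hG⟩ := lemma_G
  have hj : Integrable (fun x : ℝ => (1 + ‖x‖ ^ 2) ^ (-(3/2) / 2 : ℝ)) :=
    integrable_rpow_neg_one_add_norm_sq (r := 3/2) (by simp; norm_num)
  set J := ∫ x : ℝ, (1 + ‖x‖ ^ 2) ^ (-(3/2) / 2 : ℝ) with hJ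
  have hJ0 : 0 ≤ J := integral_nonneg fun x => by positivity
  refine ⟨C * (π + J), by positivity, ?_⟩
  intro z η hz hη hη1
  have hi1 : Integrable (fun ξ : ℝ => (η ^ 2)⁻¹ * (1 + (ξ / η) ^ 2)⁻¹) :=
    (integrable_inv_one_add_sq.comp_div hη.ne').const_mul _
  have hbd : ∀ ξ : ℝ, ‖FourierTransform.fourier (gg z η) ξ‖ ^ 2 ≤ C * ((η ^ 2)⁻¹ * (1 + (ξ / η) ^ 2)⁻¹ + (1 + ‖ξ‖ ^ 2) ^ (-(3/2) / 2 : ℝ)) := by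
    intro ξ
    rw [gg_fourier hz hη]
    refine (hG z _ hz (by simp [hη]) (by simp; linarith)).trans ?_
    simp only [add_sub_cancel_left]
    have hpi : ξ ^ 2 ≤ (2 * π * ξ) ^ 2 := by
      have : 1 ≤ (2 * π) ^ 2 := by nlinarith [Real.pi_gt_three]
      rw [mul_pow]
      nlinarith [sq_nonneg ξ]
    gcongr
    · rw [← mul_inv]
      have : η ^ 2 * (1 + (ξ / η) ^ 2) = η ^ 2 + ξ ^ 2 := by field_simp
      rw [this]
      gcongr
    · rw [Real.norm_eq_abs, sq_abs, show (-(3/2) / 2 : ℝ) = -(3/4) by norm_num]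
      exact Real.rpow_le_rpow_of_nonpos (by positivity) (by linarith) (by norm_num)
  have hI : Integrable (fun ξ : ℝ => C * ((η ^ 2)⁻¹ * (1 + (ξ / η) ^ 2)⁻¹ + (1 + ‖ξ‖ ^ 2) ^ (-(3/2) / 2 : ℝ))) :=
    (hi1.add hj).const_mul C
  have hcont := fourier_cont (gg_integrable hz hη)
  have hFI : Integrable (fun ξ : ℝ => ‖FourierTransform.fourier (gg z η) ξ‖ ^ 2) :=
    Integrable.mono' hI (hcont.norm.pow 2).aestronglyMeasurable (Filter.Eventually.of_forall fun ξ => by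
      rw [Real.norm_of_nonneg (by positivity)]; exact hbd ξ)
  have hFL : MemLp (FourierTransform.fourier (gg z η)) 2 :=
    (memLp_two_iff_integrable_sq_norm hcont.aestronglyMeasurable).2 hFI
  rw [plancherel_L1L2 (gg_integrable hz hη) (gg_memLp hz hη) hFL]
  refine (integral_mono hFI hI hbd).trans ?_
  rw [integral_const_mul, integral_add hi1 hj, integral_const_mul,
    Measure.integral_comp_div (fun x : ℝ => (1 + x ^ 2)⁻¹), integral_univ_inv_one_add_sq, ← hJ, abs_of_pos hη, smul_eq_mul, mul_div_assoc]
  gcongr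
  have : (η ^ 2)⁻¹ * (η * π) = π / η := by field_simp
  rw [this, add_div]
  gcongr
  rw [le_div_iff₀ hη]
  nlinarith

open MeasureTheory in
lemma hh_L2_local : ∃ C : ℝ, 0 ≤ C ∧ ∀ (z : ℂ) (T : ℝ), ‖z‖ ≤ 1 → 1 ≤ T → ∀ δ : ℝ, 0 < δ → δ ≤ 1 →
    IntegrableOn (fun v => ‖hh z v‖ ^ 2) (Set.Ioc T (T + δ)) ∧ 
    ∫ v in Set.Ioc T (T + δ), ‖hh z v‖ ^ 2 ≤ C * T := by
  obtain ⟨C, hC, hL⟩ := L2_bound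
  refine ⟨Real.exp 4 * C, by positivity, ?_⟩
  intro z T hz hT δ hδ hδ1
  have hT0 : 0 < T := by linarith
  have hη : 0 < 1 / T := by positivity
  have h1 := hL z (1 / T) hz hη (by rw [div_le_one hT0]; exact hT)
  have hgi : Integrable (fun v => ‖gg z (1/T) v‖ ^ 2) := (memLp_two_iff_integrable_sq_norm (measurable_gg z _).aestronglyMeasurable).1 (gg_memLp hz hη)
  have hpt : ∀ v ∈ Set.Ioc T (T + δ), ‖hh z v‖ ^ 2 ≤ Real.exp 4 * ‖gg z (1/T) v‖ ^ 2 := by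
    intro v hv
    have hv0 : 0 < v := by linarith [hv.1]
    rw [gg, Set.indicator_of_mem (show v ∈ Set.Ioi (0:ℝ) from hv0), norm_mul, Complex.norm_exp, mul_pow]
    have e : (-(((1 / T : ℝ) : ℂ) * (v:ℂ))).re = -(v / T) := by
      rw [← Complex.ofReal_mul, ← Complex.ofReal_neg, Complex.ofReal_re]; ring
    rw [e, ← Real.exp_nat_mul, mul_left_comm, ← Real.exp_add]
    refine le_mul_of_one_le_right (by positivity) (Real.one_le_exp ?_)
    have : v / T ≤ 2 := by
      rw [div_le_iff₀ hT0]; linarith [hv.2]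
    push_cast; linarith
  have hgint : IntegrableOn (fun v => Real.exp 4 * ‖gg z (1/T) v‖ ^ 2) (Set.Ioc T (T + δ)) := (hgi.const_mul _).integrableOn
  have hhi : IntegrableOn (fun v => ‖hh z v‖ ^ 2) (Set.Ioc T (T + δ)) := by
    refine Integrable.mono' hgint ((measurable_hh z).norm.pow_const 2).aestronglyMeasurable ?_
    filter_upwards [ae_restrict_mem measurableSet_Ioc] with v hv
    rw [Real.norm_of_nonneg (by positivity)]; exact hpt v hv
  refine ⟨hhi, ?_⟩
  calc _ ≤ ∫ v in Set.Ioc T (T + δ), Real.exp 4 * ‖gg z (1/T) v‖ ^ 2 := setIntegral_mono_on hhi hgint measurableSet_Ioc hpt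
    _ ≤ ∫ v, Real.exp 4 * ‖gg z (1/T) v‖ ^ 2 := setIntegral_le_integral (hgi.const_mul _) (Filter.Eventually.of_forall fun v => by positivity)
    _ = Real.exp 4 * ∫ v, ‖gg z (1/T) v‖ ^ 2 := integral_const_mul _ _
    _ ≤ Real.exp 4 * (C / (1 / T)) := by gcongr
    _ = _ := by field_simp

lemma S1_diff {z : ℂ} (hz : ‖z‖ ≤ 1) {x y : ℝ} (hx : 1 ≤ x) (hxy : x ≤ y) :
    ‖S1 z y - S1 z x‖ ≤ (y - x + 1) * Real.log y := by
  have hfl : ⌊x⌋₊ ≤ ⌊y⌋₊ := Nat.floor_le_floor hxy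
  have h1 : S1 z y - S1 z x = ∑ k ∈ Finset.Ioc ⌊x⌋₊ ⌊y⌋₊, LSeries.logMul (fun n => z ^ bigOmega n) k := by
    unfold S1
    rw [sub_eq_iff_eq_add, add_comm]
    rw [show Finset.Icc 1 ⌊y⌋₊ = Finset.Icc 1 ⌊x⌋₊ ∪ Finset.Ioc ⌊x⌋₊ ⌊y⌋₊ by
      ext k; simp only [Finset.mem_Icc, Finset.mem_union, Finset.mem_Ioc]; omega]
    refine Finset.sum_union ?_
    rw [Finset.disjoint_left]
    intro k hk hk'
    simp only [Finset.mem_Icc, Finset.mem_Ioc] at hk hk'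
    omega
  have hy1 : 1 ≤ y := hx.trans hxy
  have hly := Real.log_nonneg hy1
  calc _ ≤ ∑ k ∈ Finset.Ioc ⌊x⌋₊ ⌊y⌋₊, Real.log y := by
        rw [h1]
        refine norm_sum_le_of_le _ fun k hk => (logMul_norm hz).trans ?_
        rw [Finset.mem_Ioc] at hk
        refine Real.log_le_log (by exact_mod_cast (by omega : 0 < k)) ?_
        exact (by exact_mod_cast hk.2 : (k:ℝ) ≤ ⌊y⌋₊).trans (Nat.floor_le (by linarith))
    _ = (⌊y⌋₊ - ⌊x⌋₊ : ℝ) * Real.log y := by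
        simp [Nat.cast_sub hfl]
    _ ≤ _ := by
        gcongr
        have := Nat.floor_le (show 0 ≤ y by linarith)
        have := Nat.lt_floor_add_one x
        linarith

lemma hh_osc : ∃ C : ℝ, 0 ≤ C ∧ ∀ (z : ℂ) (T : ℝ), ‖z‖ ≤ 1 → 1 ≤ T → ∀ v : ℝ, T ≤ v → v ≤ T + T ^ (-(1/3) : ℝ) →
    ‖hh z v - hh z T‖ ≤ C * T ^ (2/3 : ℝ) := by
  obtain ⟨D, hD0, hD⟩ := mm_bound
  refine ⟨5 + D, by positivity, ?_⟩
  intro z T hz hT v hv1 hv2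
  have hT0 : 0 < T := by linarith
  set δ := T ^ (-(1/3) : ℝ) with hδ
  have hδ0 : 0 < δ := by positivity
  have hδ1 : δ ≤ 1 := Real.rpow_le_one_of_one_le_of_nonpos hT (by norm_num)
  have hδT : δ * T = T ^ (2/3 : ℝ) := by
    rw [hδ, ← Real.rpow_add_one hT0.ne']; norm_num
  have hT23 : 1 ≤ T ^ (2/3 : ℝ) := Real.one_le_rpow hT (by norm_num)
  have hvT : v - T ≤ δ := by linarith
  -- exponential decay comparison
  have hexp : 1 - Real.exp (-(v - T)) ≤ v - T := by
    have := Real.add_one_le_exp (-(v - T)); linarith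
  have hexp0 : 0 ≤ 1 - Real.exp (-(v - T)) := by
    have : Real.exp (-(v - T)) ≤ 1 := Real.exp_le_one_iff.2 (by linarith)
    linarith
  have hA : ‖Complex.exp (-v) * S1 z (Real.exp v) - Complex.exp (-T) * S1 z (Real.exp T)‖ ≤ 5 * T ^ (2/3 : ℝ) := by
    have e1 : Complex.exp (-v) * S1 z (Real.exp v) - Complex.exp (-T) * S1 z (Real.exp T) =
        Complex.exp (-v) * (S1 z (Real.exp v) - S1 z (Real.exp T)) + (Complex.exp (-(v - T)) - 1) * (Complex.exp (-T) * S1 z (Real.exp T)) := by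
      have : Complex.exp (-(v - T)) * Complex.exp (-T) = Complex.exp (-v) := by
        rw [← Complex.exp_add]; congr 1; ring
      rw [sub_mul, ← mul_assoc (Complex.exp (-(v - T))), this]; ring
    rw [e1]
    refine (norm_add_le _ _).trans ?_
    have b1 : ‖Complex.exp (-v) * (S1 z (Real.exp v) - S1 z (Real.exp T))‖ ≤ (δ + Real.exp (-T)) * (T + 1) := by
      rw [norm_mul, Complex.norm_exp]
      have := S1_diff hz (Real.one_le_exp hT0.le) (Real.exp_le_exp.2 hv1)
      rw [Real.log_exp] at this
      simp only [Complex.neg_re, Complex.ofReal_re]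
      calc _ ≤ Real.exp (-v) * ((Real.exp v - Real.exp T + 1) * v) := by gcongr
        _ = (1 - Real.exp (-(v - T)) + Real.exp (-v)) * v := by
            have a1 : Real.exp (-v) * Real.exp v = 1 := by rw [← Real.exp_add]; simp
            have a2 : Real.exp (-v) * Real.exp T = Real.exp (-(v - T)) := by rw [← Real.exp_add]; congr 1; ring
            linear_combination v * a1 - v * a2
        _ ≤ _ := by
            gcongr <;> linarith
    have b2 : ‖(Complex.exp (-(v - T)) - 1) * (Complex.exp (-T) * S1 z (Real.exp T))‖ ≤ δ * T := by
      rw [norm_mul]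
      have a1 := expS1_norm hz hT0.le
      have a2 : ‖Complex.exp (-(v - T)) - 1‖ ≤ δ := by
        have : Complex.exp (-((v:ℂ) - T)) - 1 = ((Real.exp (-(v - T)) - 1 : ℝ) : ℂ) := by push_cast; rfl
        rw [this, Complex.norm_real, Real.norm_eq_abs, abs_of_nonpos (by linarith)]
        linarith
      gcongr
    have b3 : Real.exp (-T) * (T + 1) ≤ 1 := by
      have := Real.add_one_le_exp T
      calc _ ≤ Real.exp (-T) * Real.exp T := by gcongr
        _ = 1 := by rw [← Real.exp_add]; simp
    nlinarith
  have hB : ‖mm z * (v:ℂ) ^ z - mm z * (T:ℂ) ^ z‖ ≤ D * T ^ (2/3 : ℝ) := by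
    by_cases hzs : 0 ≤ z.re
    · rw [← mul_sub, norm_mul]
      have h1 : z.re ≤ 1 := (Complex.re_le_norm z).trans hz
      have hd : ∀ x ∈ Set.Icc T v, HasDerivWithinAt (fun v : ℝ => (v : ℂ) ^ z) (z * (x : ℂ) ^ (z - 1)) (Set.Icc T v) x := by
        intro x hx
        have hx0 : 0 < x := by linarith [hx.1]
        have := (hasDerivAt_id (x:ℂ)).cpow_const (c := z) (Or.inl (by simpa using hx0))
        simpa using this.comp_ofReal.hasDerivWithinAt
      have := Convex.norm_image_sub_le_of_norm_hasDerivWithin_le (C := 1) hd ?_ (convex_Icc T v) (Set.left_mem_Icc.2 hv1) (Set.right_mem_Icc.2 hv1)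
      · have h2 : ‖(v:ℂ) ^ z - (T:ℂ) ^ z‖ ≤ T ^ (2/3 : ℝ) := by
          refine this.trans ?_
          rw [Real.norm_eq_abs, abs_of_nonneg (by linarith)]
          linarith
        gcongr
        exact hD z hz
      · intro x hx
        have hx1 : 1 ≤ x := hT.trans hx.1
        rw [norm_mul, Complex.norm_cpow_eq_rpow_re_of_pos (by linarith)]
        have := Real.rpow_le_one_of_one_le_of_nonpos hx1 (z := (z-1).re) (by simp; exact h1)
        exact mul_le_one₀ hz (by positivity) this
    · rw [mm_of_neg hzs]; simp; positivity
  have : hh z v - hh z T = (Complex.exp (-v) * S1 z (Real.exp v) - Complex.exp (-T) * S1 z (Real.exp T)) -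
      (mm z * (v:ℂ) ^ z - mm z * (T:ℂ) ^ z) := by unfold hh; ring
  rw [this]
  refine (norm_sub_le _ _).trans ?_
  linarith

open MeasureTheory in
lemma hh_bound : ∃ C : ℝ, 0 ≤ C ∧ ∀ (z : ℂ) (T : ℝ), ‖z‖ ≤ 1 → 1 ≤ T → ‖hh z T‖ ≤ C * T ^ (2/3 : ℝ) := by
  obtain ⟨C1, hC1, h1⟩ := hh_L2_local
  obtain ⟨C2, hC2, h2⟩ := hh_osc
  refine ⟨Real.sqrt (2 * C1 + 2 * C2 ^ 2), by positivity, ?_⟩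
  intro z T hz hT
  have hT0 : 0 < T := by linarith
  set δ := T ^ (-(1/3) : ℝ) with hδ
  have hδ0 : 0 < δ := by positivity
  have hδ1 : δ ≤ 1 := Real.rpow_le_one_of_one_le_of_nonpos hT (by norm_num)
  obtain ⟨hi, hb⟩ := h1 z T hz hT δ hδ0 hδ1
  have hpt : ∀ v ∈ Set.Ioc T (T + δ), ‖hh z T‖ ^ 2 ≤ 2 * ‖hh z v‖ ^ 2 + 2 * (C2 * T ^ (2/3 : ℝ)) ^ 2 := by
    intro v hv
    have h3 := h2 z T hz hT v hv.1.le hv.2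
    have h4 := norm_le_norm_add_norm_sub (hh z v) (hh z T)
    have h5 : ‖hh z T‖ ≤ ‖hh z v‖ + C2 * T ^ (2/3 : ℝ) := by linarith
    have h6 := pow_le_pow_left₀ (norm_nonneg _) h5 2
    nlinarith [sq_nonneg (‖hh z v‖ - C2 * T ^ (2/3 : ℝ))]
  have hconst : ∀ c : ℝ, ∫ v in Set.Ioc T (T + δ), c = δ * c := by
    intro c
    rw [setIntegral_const]; simp [hδ0.le]
  have hic : ∀ c : ℝ, IntegrableOn (fun _ : ℝ => c) (Set.Ioc T (T+δ)) := fun c => integrableOn_const (by simp)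
  have h3 := setIntegral_mono_on (hic (‖hh z T‖ ^ 2)) ((hi.const_mul 2).add (hic (2 * (C2 * T ^ (2/3 : ℝ)) ^ 2))) measurableSet_Ioc hpt
  simp only [Pi.add_apply] at h3
  rw [integral_add (hi.const_mul 2) (hic _), hconst, hconst, integral_const_mul] at h3
  have h4 : T = δ * (T ^ (2/3 : ℝ)) ^ 2 := by
    rw [hδ, ← Real.rpow_natCast, ← Real.rpow_mul hT0.le, ← Real.rpow_add hT0]; norm_num
  have h5 : δ * ‖hh z T‖ ^ 2 ≤ δ * ((2 * C1 + 2 * C2 ^ 2) * (T ^ (2/3 : ℝ)) ^ 2) := by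
    calc _ ≤ _ := h3
      _ ≤ 2 * (C1 * T) + δ * (2 * (C2 * T ^ (2/3 : ℝ)) ^ 2) := by gcongr
      _ = _ := by
        nth_rewrite 1 [h4]
        ring
  have h6 := le_of_mul_le_mul_left h5 hδ0
  refine le_of_pow_le_pow_left₀ (n := 2) (by norm_num) (by positivity) ?_
  rw [mul_pow, Real.sq_sqrt (by positivity)]
  exact h6

def chi (n : ℕ) (z : ℂ) : ℂ := (∑ k ∈ Finset.Icc 1 n, z ^ bigOmega k) / n

lemma sum_log_bound (n : ℕ) (hn : 1 ≤ n) : ∑ k ∈ Finset.Icc 1 n, (Real.log n - Real.log k) ≤ n := by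
  have h1 : ∑ k ∈ Finset.Icc 1 n, Real.log k = Real.log n.factorial := by
    clear hn
    induction n with
    | zero => simp
    | succ m ih =>
      rw [Finset.sum_Icc_succ_top (by omega), ih, Nat.factorial_succ, Nat.cast_mul, Real.log_mul, add_comm]
      · exact_mod_cast m.succ_ne_zero
      · exact_mod_cast m.factorial_ne_zero
  have hn0 : (0:ℝ) < n := by exact_mod_cast hn
  have hf0 : (0:ℝ) < n.factorial := by exact_mod_cast n.factorial_pos
  have h2 := Real.pow_div_factorial_le_exp n hn0.le n
  have h3 := Real.log_le_log (by positivity) h2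
  rw [Real.log_exp, Real.log_div (by positivity) hf0.ne', Real.log_pow] at h3
  rw [Finset.sum_sub_distrib, h1]
  simpa using h3

lemma chi_main : ∃ C : ℝ, 0 ≤ C ∧ ∀ (z : ℂ) (n : ℕ), ‖z‖ ≤ 1 → 16 ≤ n →
    ‖chi n z - mm z * ((Real.log n : ℝ) : ℂ) ^ (z - 1)‖ ≤ C * (Real.log n) ^ (-(1/3) : ℝ) := by
  obtain ⟨C, hC, h⟩ := hh_bound
  refine ⟨C + 1, by positivity, ?_⟩
  intro z n hz hn
  have hn0 : (0:ℝ) < n := by positivity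
  have hnC : (n:ℂ) ≠ 0 := by exact_mod_cast hn0.ne'
  set T := Real.log n with hT
  have hT1 : 1 ≤ T := by
    rw [hT, Real.le_log_iff_exp_le hn0]
    have : (16:ℝ) ≤ n := by exact_mod_cast hn
    linarith [Real.exp_one_lt_d9]
  have hT0 : 0 < T := by linarith
  have hTC : (T:ℂ) ≠ 0 := by exact_mod_cast hT0.ne'
  have h1 := h z T hz hT1
  have hexp : Real.exp T = n := Real.exp_log hn0
  have h2 : hh z T = S1 z n / n - mm z * (T:ℂ) ^ z := by
    rw [hh, hexp, Complex.exp_neg, ← Complex.ofReal_exp, hexp]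
    push_cast
    ring
  have h3 : ‖T * chi n z - S1 z n / n‖ ≤ 1 := by
    have e : T * chi n z - S1 z n / n = (∑ k ∈ Finset.Icc 1 n, ((T - Real.log k : ℝ) : ℂ) * z ^ bigOmega k) / n := by
      rw [chi, S1, Nat.floor_natCast, mul_div_assoc', ← sub_div, Finset.mul_sum, ← Finset.sum_sub_distrib]
      congr 1
      refine Finset.sum_congr rfl fun k _ => ?_
      rw [LSeries.logMul, ← Complex.natCast_log]
      push_cast; ring
    rw [e, norm_div, Complex.norm_natCast, div_le_one hn0]
    refine le_trans ?_ (sum_log_bound n (by omega))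
    refine norm_sum_le_of_le _ fun k hk => ?_
    rw [Finset.mem_Icc] at hk
    have : 0 ≤ T - Real.log k := by
      have : Real.log k ≤ Real.log n := Real.log_le_log (by exact_mod_cast hk.1) (by exact_mod_cast hk.2)
      linarith
    rw [norm_mul, Complex.norm_real, Real.norm_of_nonneg this]
    exact mul_le_of_le_one_right this (norm_zpow_le hz k)
  have h4 : T * (chi n z - mm z * (T:ℂ) ^ (z - 1)) = (T * chi n z - S1 z n / n) + hh z T := by
    rw [h2, Complex.cpow_sub _ _ hTC, Complex.cpow_one]; field_simp; ring
  have h5 : T * ‖chi n z - mm z * (T:ℂ) ^ (z - 1)‖ ≤ (C + 1) * T ^ (2/3 : ℝ) := by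
    have e : ‖(T:ℂ) * (chi n z - mm z * (T:ℂ) ^ (z - 1))‖ = T * ‖chi n z - mm z * (T:ℂ) ^ (z - 1)‖ := by
      rw [norm_mul, Complex.norm_real, Real.norm_of_nonneg hT0.le]
    rw [← e, h4]
    refine (norm_add_le _ _).trans ?_
    have : 1 ≤ T ^ (2/3 : ℝ) := Real.one_le_rpow hT1 (by norm_num)
    linarith
  refine le_of_mul_le_mul_left (h5.trans (le_of_eq ?_)) hT0
  rw [mul_left_comm, ← Real.rpow_one_add' hT0.le (by norm_num)]
  norm_num

lemma prime_inv_facts {z : ℂ} (hz : ‖z‖ ≤ 3/2) (p : Nat.Primes) :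
    ‖(p : ℂ)⁻¹‖ ≤ 1/2 ∧ ‖z * (p : ℂ)⁻¹‖ ≤ 3/4 := by
  have h2 : (2:ℝ) ≤ p := by exact_mod_cast p.2.two_le
  have h1 : ‖(p : ℂ)⁻¹‖ ≤ 1/2 := by
    rw [norm_inv, Complex.norm_natCast, inv_le_comm₀ (by linarith) (by norm_num)]
    norm_num; exact_mod_cast p.2.two_le
  refine ⟨h1, ?_⟩
  rw [norm_mul]
  nlinarith [norm_nonneg z, norm_nonneg ((p : ℂ)⁻¹)]

lemma Wt_one (z : ℂ) (p : Nat.Primes) : Wt z 1 p =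
    -Complex.log (1 - z * (p : ℂ)⁻¹) + z * Complex.log (1 - (p : ℂ)⁻¹) := by
  rw [Wt, Complex.cpow_neg_one]

lemma Wt_one_bound {z : ℂ} (hz : ‖z‖ ≤ 3/2) (p : Nat.Primes) :
    ‖Wt z 1 p‖ ≤ 8 * (p : ℝ) ^ (-2 : ℝ) := by
  obtain ⟨h1, h2⟩ := prime_inv_facts hz p
  rw [Wt_one]
  refine (log_quad hz (by linarith) h2).trans (le_of_eq ?_)
  rw [norm_inv, Complex.norm_natCast, Real.rpow_neg (by positivity)]
  norm_num

lemma prod_term {w : ℂ} (hw : ‖1 + w‖ ≤ 3/2) (q : Nat.Primes) :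
    (1 - w / (((q : ℕ) : ℂ) - 1))⁻¹ * (1 - 1 / ((q : ℕ) : ℂ)) ^ w = Complex.exp (Wt (1 + w) 1 q) := by
  obtain ⟨h1, h2⟩ := prime_inv_facts hw q
  have hq : ((q:ℕ) : ℂ) ≠ 0 := by exact_mod_cast q.2.ne_zero
  have hq1 : ((q:ℕ) : ℂ) - 1 ≠ 0 := by
    rw [sub_ne_zero]; exact_mod_cast q.2.one_lt.ne'
  have a1 : 1 - ((q:ℕ) : ℂ)⁻¹ ≠ 0 := Complex.slitPlane_ne_zero (one_sub_mem_slit (by linarith))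
  have a2 : 1 - (1 + w) * ((q:ℕ) : ℂ)⁻¹ ≠ 0 := Complex.slitPlane_ne_zero (one_sub_mem_slit h2)
  rw [Wt_one, Complex.exp_add, Complex.exp_neg, Complex.exp_log a2, add_mul 1 w (Complex.log _), one_mul, Complex.exp_add,
    Complex.exp_log a1, one_div, Complex.cpow_def_of_ne_zero a1, mul_comm w, ← mul_assoc]
  congr 1
  have e : 1 - w / (((q : ℕ) : ℂ) - 1) = (1 - (1 + w) * ((q:ℕ) : ℂ)⁻¹) / (1 - ((q:ℕ) : ℂ)⁻¹) := by
    rw [eq_div_iff a1]; field_simp; ring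
  rw [e, inv_div, div_eq_mul_inv, mul_comm]
  

lemma Phi2_eq {w : ℂ} (hw : ‖1 + w‖ ≤ 3/2) : Phi2 w = 1 / Complex.Gamma (1 + w) * cz (1 + w) := by
  have hs : Summable (Wt (1 + w) 1) :=
    Summable.of_norm_bounded ((summable_primes_rpow (by norm_num : (1:ℝ) < 2)).mul_left 8) (Wt_one_bound hw)
  rw [Phi2, cz, Wz, ← hs.hasSum.cexp.tprod_eq]
  congr 1
  refine tprod_congr fun q => ?_
  rw [prod_term hw]; rfl

lemma mm_eq_Phi2 {z : ℂ} (hz : ‖z‖ ≤ 1) (h0 : z ≠ 0) (hre : 0 ≤ z.re) : mm z = Phi2 (z - 1) := by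
  rw [Phi2_eq (by rw [add_sub_cancel]; linarith), add_sub_cancel, mm, mz, if_pos hre, Complex.Gamma_add_one _ h0]
  field_simp

lemma Phi2_diff : DifferentiableOn ℂ Phi2 (Metric.ball 0 (1/2)) := by
  have hb : ∀ w ∈ Metric.ball (0:ℂ) (1/2), ‖1 + w‖ ≤ 3/2 := by
    intro w hw
    rw [mem_ball_zero_iff] at hw
    have := norm_add_le 1 w
    rw [norm_one] at this
    linarith
  have h1 : DifferentiableOn ℂ (fun w => Wz (1 + w) 1) (Metric.ball 0 (1/2)) := by
    refine Complex.differentiableOn_tsum_of_summable_norm (u := fun p : Nat.Primes => 8 * (p : ℝ) ^ (-2 : ℝ)) ((summable_primes_rpow (by norm_num : (1:ℝ) < 2)).mul_left 8) ?_ Metric.isOpen_ball ?_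
    · intro p
      simp_rw [Wt_one]
      intro w hw
      obtain ⟨h1, h2⟩ := prime_inv_facts (hb w hw) p
      refine DifferentiableAt.differentiableWithinAt ?_
      refine DifferentiableAt.add (DifferentiableAt.neg (DifferentiableAt.clog (by fun_prop) (one_sub_mem_slit h2))) (by fun_prop)
    · intro p w hw
      exact Wt_one_bound (hb w hw) p
  have h2 : DifferentiableOn ℂ (fun w => (Complex.Gamma (1 + w))⁻¹ * Complex.exp (Wz (1 + w) 1)) (Metric.ball 0 (1/2)) := by
    refine DifferentiableOn.mul ?_ h1.cexp
    exact (Complex.differentiable_one_div_Gamma.comp (differentiable_id.const_add 1)).differentiableOn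
  refine h2.congr fun w hw => ?_
  rw [Phi2_eq (hb w hw), one_div]; rfl

lemma Phi2_zero : Phi2 0 = 1 := by
  rw [Phi2_eq (by norm_num)]
  simp [cz, Wz, Wt]

lemma taylorCoeff_zero : taylorCoeff Phi2 0 = 1 := by
  simp [taylorCoeff, Phi2_zero]

def Pr (r : ℕ) (w : ℂ) : ℂ := ∑ l ∈ Finset.range (r + 1), taylorCoeff Phi2 l * w ^ l

lemma Phi2_taylor (r : ℕ) : ∃ C ρ : ℝ, 0 ≤ C ∧ 0 < ρ ∧ ρ ≤ 1/2 ∧ ∀ w : ℂ, ‖w‖ ≤ ρ →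
    ‖Phi2 w - Pr r w‖ ≤ C * ‖w‖ ^ (r + 1) := by
  have ha : AnalyticAt ℂ Phi2 0 := Phi2_diff.analyticAt (Metric.ball_mem_nhds _ (by norm_num))
  have h1 := ha.hasFPowerSeriesAt.isBigO_sub_partialSum_pow (r + 1)
  obtain ⟨C, hC, h2⟩ := h1.exists_pos
  rw [Asymptotics.IsBigOWith, Metric.eventually_nhds_iff] at h2
  obtain ⟨ε, hε, h3⟩ := h2
  refine ⟨C, min (1/2) (ε/2), hC.le, by positivity, min_le_left _ _, ?_⟩
  intro w hw
  have h4 := h3 (y := w) (by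
    rw [dist_zero_right]; 
    have := hw.trans (min_le_right _ _)
    linarith)
  rw [zero_add, norm_pow, norm_norm] at h4
  refine le_trans (le_of_eq ?_) h4
  congr 2
  rw [Pr, FormalMultilinearSeries.partialSum]
  refine Finset.sum_congr rfl fun l _ => ?_
  rw [FormalMultilinearSeries.ofScalars_apply_eq]
  rw [taylorCoeff, smul_eq_mul]

lemma exp_I_facts (θ : ℝ) : ‖Complex.exp (Complex.I * θ)‖ = 1 := by
  rw [mul_comm]; exact Complex.norm_exp_ofReal_mul_I θ

lemma mm_taylor (r : ℕ) : ∃ C : ℝ, 0 ≤ C ∧ ∀ θ : ℝ, 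
    ‖mm (Complex.exp (Complex.I * θ)) - Pr r (Complex.exp (Complex.I * θ) - 1)‖ ≤ C * |θ| ^ (r + 1) := by
  obtain ⟨C, ρ, hC, hρ, hρ2, h⟩ := Phi2_taylor r
  obtain ⟨D, hD0, hD⟩ := mm_bound
  set B := D + ∑ l ∈ Finset.range (r + 1), ‖taylorCoeff Phi2 l‖ * 2 ^ l with hB
  have hB0 : 0 ≤ B := by positivity
  refine ⟨C + B / ρ ^ (r + 1), by positivity, ?_⟩
  intro θ
  set z := Complex.exp (Complex.I * θ) with hz
  have hz1 : ‖z‖ = 1 := exp_I_facts θ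
  have hzθ : ‖z - 1‖ ≤ |θ| := Real.norm_exp_I_mul_ofReal_sub_one_le
  by_cases hc : ‖z - 1‖ ≤ ρ
  · have hre : 0 ≤ z.re := by
      have := Complex.abs_re_le_norm (z - 1)
      have := abs_le.1 (this.trans hc)
      simp only [Complex.sub_re, Complex.one_re] at this
      linarith [this.1]
    rw [mm_eq_Phi2 hz1.le (by rw [← norm_ne_zero_iff, hz1]; norm_num) hre]
    calc _ ≤ C * ‖z - 1‖ ^ (r + 1) := h _ hc
      _ ≤ C * |θ| ^ (r + 1) := by gcongr
      _ ≤ _ := by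
        gcongr
        have : 0 ≤ B / ρ ^ (r + 1) := by positivity
        linarith
  · push Not at hc
    have hθ : ρ ≤ |θ| := hc.le.trans hzθ
    have h2 : ‖z - 1‖ ≤ 2 := (norm_sub_le _ _).trans (by rw [hz1, norm_one]; norm_num)
    calc _ ≤ ‖mm z‖ + ‖Pr r (z - 1)‖ := norm_sub_le _ _
      _ ≤ B := by
        rw [hB]
        gcongr
        · exact hD z hz1.le
        · refine norm_sum_le_of_le _ fun l _ => ?_
          rw [norm_mul, norm_pow]; gcongr
      _ = B / ρ ^ (r + 1) * ρ ^ (r + 1) := by field_simp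
      _ ≤ B / ρ ^ (r + 1) * |θ| ^ (r + 1) := by gcongr
      _ ≤ _ := by
        gcongr; linarith

def Zt (θ : ℝ) : ℂ := Complex.exp (Complex.I * θ)

lemma Zt_norm (θ : ℝ) : ‖Zt θ‖ = 1 := exp_I_facts θ

lemma Zt_sub_one (θ : ℝ) : ‖Zt θ - 1‖ ≤ |θ| := Real.norm_exp_I_mul_ofReal_sub_one_le

lemma Zt_pow (θ : ℝ) (m : ℕ) : Zt θ ^ m = Zt (m * θ) := by
  rw [Zt, Zt, ← Complex.exp_nat_mul]; congr 1; push_cast; ring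

lemma Zt_re (θ : ℝ) : (Zt θ).re = Real.cos θ := by
  rw [Zt, mul_comm, Complex.exp_ofReal_mul_I_re]

lemma continuous_Zt : Continuous Zt := by unfold Zt; fun_prop

lemma exp_sub_one_le_of_re {u : ℂ} (hu : u.re ≤ 0) : ‖Complex.exp u - 1‖ ≤ ‖u‖ := by
  have := (convex_halfSpace_re_le 0).norm_image_sub_le_of_norm_deriv_le (𝕜 := ℂ) (f := Complex.exp) (C := 1) (x := 0) (y := u)
    (fun w _ => Complex.differentiableAt_exp) (fun w hw => by
      rw [Complex.deriv_exp, Complex.norm_exp]; exact Real.exp_le_one_iff.2 hw) (by simp) hu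
  simpa using this

lemma bigOmega_le (k : ℕ) (hk : 1 ≤ k) : (bigOmega k : ℝ) ≤ 2 * Real.log k := by
  have h1 : 2 ^ bigOmega k ≤ k := by
    conv_rhs => rw [← Nat.prod_primeFactorsList (show k ≠ 0 by omega)]
    exact List.pow_card_le_prod _ _ fun p hp => (Nat.prime_of_mem_primeFactorsList hp).two_le
  have h2 : (2:ℝ) ^ bigOmega k ≤ k := by exact_mod_cast h1
  have h3 := Real.log_le_log (by positivity) h2
  rw [Real.log_pow] at h3
  have := Real.log_two_gt_d9
  have h4 : (0:ℝ) ≤ bigOmega k := by positivity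
  nlinarith

lemma chi_sub_one (n : ℕ) (hn : 16 ≤ n) (θ : ℝ) : ‖chi n (Zt θ) - 1‖ ≤ 2 * Real.log n * |θ| := by
  have hn0 : (0:ℝ) < n := by positivity
  have hnC : (n:ℂ) ≠ 0 := by exact_mod_cast hn0.ne'
  have e : chi n (Zt θ) - 1 = (∑ k ∈ Finset.Icc 1 n, (Zt θ ^ bigOmega k - 1)) / n := by
    rw [chi, Finset.sum_sub_distrib, sub_div]; simp [hnC]
  rw [e, norm_div, Complex.norm_natCast, div_le_iff₀ hn0]
  calc _ ≤ ∑ k ∈ Finset.Icc 1 n, 2 * Real.log n * |θ| := by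
        refine norm_sum_le_of_le _ fun k hk => ?_
        rw [Finset.mem_Icc] at hk
        rw [Zt_pow]
        refine (Zt_sub_one _).trans ?_
        rw [abs_mul, Nat.abs_cast]
        gcongr
        refine (bigOmega_le k hk.1).trans ?_
        gcongr
        · exact_mod_cast hk.1
        · exact hk.2
    _ = _ := by simp; ring

lemma logn_facts (n : ℕ) (hn : 16 ≤ n) : 2 ≤ Real.log n ∧ 1 ≤ Real.log (Real.log n) ∧
    Real.log (Real.log n) ≤ Real.log n := by
  have h16 : (16:ℝ) ≤ n := by exact_mod_cast hn
  have h1 : 4 * Real.log 2 ≤ Real.log n := by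
    rw [show (4:ℝ) * Real.log 2 = Real.log 16 by
      rw [show (16:ℝ) = 2 ^ 4 by norm_num, Real.log_pow]; norm_num]
    exact Real.log_le_log (by norm_num) h16
  have h2 := Real.log_two_gt_d9
  have h3 := Real.exp_one_lt_d9
  refine ⟨by linarith, ?_, ?_⟩
  · rw [Real.le_log_iff_exp_le (by linarith)]; linarith
  · have := Real.log_le_sub_one_of_pos (show 0 < Real.log n by linarith); linarith

def nuhat (r : ℕ) (lam : ℝ) (θ : ℝ) : ℂ := Complex.exp (lam * (Zt θ - 1)) * Pr r (Zt θ - 1)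

lemma cpow_eq_exp {n : ℕ} (hn : 16 ≤ n) (w : ℂ) : ((Real.log n : ℝ) : ℂ) ^ w =
    Complex.exp ((Real.log (Real.log n) : ℝ) * w) := by
  obtain ⟨h1, h2, h3⟩ := logn_facts n hn
  rw [Complex.cpow_def_of_ne_zero (by exact_mod_cast (by linarith : Real.log n ≠ 0)), ← Complex.ofReal_log (by linarith)]

lemma norm_exp_Zt {lam θ : ℝ} : ‖Complex.exp (lam * (Zt θ - 1))‖ = Real.exp (lam * (Real.cos θ - 1)) := by
  rw [Complex.norm_exp, Complex.re_ofReal_mul, Complex.sub_re, Zt_re, Complex.one_re]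

lemma err_first : ∃ A : ℝ, 0 ≤ A ∧ ∀ n : ℕ, 16 ≤ n → ∀ θ : ℝ,
    ‖chi n (Zt θ) - mm (Zt θ) * Complex.exp ((Real.log (Real.log n) : ℝ) * (Zt θ - 1))‖ ≤
      A * (Real.log n) ^ (-(1/6) : ℝ) * |θ| ^ (1/8 : ℝ) := by
  obtain ⟨C, hC, h⟩ := chi_main
  obtain ⟨C0, hC0, hm⟩ := mm_taylor 0
  set A := max C (C0 + 3) with hA
  have hA0 : 0 ≤ A := le_max_of_le_left hC
  refine ⟨A, hA0, ?_⟩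
  intro n hn θ
  obtain ⟨h1, h2, h3⟩ := logn_facts n hn
  set T := Real.log n with hT
  set lam := Real.log T with hlam
  have hT0 : 0 < T := by linarith
  have b1 : ‖chi n (Zt θ) - mm (Zt θ) * Complex.exp ((lam : ℝ) * (Zt θ - 1))‖ ≤ A * T ^ (-(1/3) : ℝ) := by
    have := h (Zt θ) n (Zt_norm θ).le hn
    rw [cpow_eq_exp hn] at this
    refine this.trans ?_
    gcongr
    exact le_max_left _ _
  have hre : ((lam : ℂ) * (Zt θ - 1)).re ≤ 0 := by
    rw [Complex.re_ofReal_mul, Complex.sub_re, Zt_re, Complex.one_re]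
    nlinarith [Real.cos_le_one θ]
  have hE1 : ‖Complex.exp ((lam : ℝ) * (Zt θ - 1))‖ ≤ 1 := by
    rw [Complex.norm_exp]; exact Real.exp_le_one_iff.2 hre
  have b2 : ‖chi n (Zt θ) - mm (Zt θ) * Complex.exp ((lam : ℝ) * (Zt θ - 1))‖ ≤ A * (T * |θ|) := by
    have e : chi n (Zt θ) - mm (Zt θ) * Complex.exp ((lam : ℝ) * (Zt θ - 1)) =
      (chi n (Zt θ) - 1) - (mm (Zt θ) - 1) * Complex.exp ((lam : ℝ) * (Zt θ - 1)) - (Complex.exp ((lam : ℝ) * (Zt θ - 1)) - 1) := by ring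
    have c1 := chi_sub_one n hn θ
    have c2 : ‖mm (Zt θ) - 1‖ ≤ C0 * |θ| := by
      have := hm θ
      simpa [Pr, taylorCoeff_zero, Zt] using this
    have c3 : ‖Complex.exp ((lam : ℝ) * (Zt θ - 1)) - 1‖ ≤ T * |θ| := by
      refine (exp_sub_one_le_of_re hre).trans ?_
      rw [norm_mul, Complex.norm_real, Real.norm_of_nonneg (by linarith)]
      exact mul_le_mul h3 (Zt_sub_one θ) (norm_nonneg _) hT0.le
    have c4 : ‖(mm (Zt θ) - 1) * Complex.exp ((lam : ℝ) * (Zt θ - 1))‖ ≤ C0 * |θ| := by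
      rw [norm_mul]
      calc _ ≤ (C0 * |θ|) * 1 := by gcongr
        _ = _ := by ring
    rw [e]
    have hθ := abs_nonneg θ
    calc _ ≤ 2 * T * |θ| + C0 * |θ| + T * |θ| := (norm_sub_le _ _).trans (add_le_add ((norm_sub_le _ _).trans (add_le_add c1 c4)) c3)
      _ ≤ (C0 + 3) * (T * |θ|) := by
        have : C0 * |θ| ≤ C0 * (T * |θ|) := by
          refine mul_le_mul_of_nonneg_left ?_ hC0
          nlinarith
        linarith
      _ ≤ _ := by gcongr; exact le_max_right _ _
  set a := ‖chi n (Zt θ) - mm (Zt θ) * Complex.exp ((lam : ℝ) * (Zt θ - 1))‖ with ha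
  have ha0 : 0 ≤ a := norm_nonneg _
  calc a = a ^ (7/8 : ℝ) * a ^ (1/8 : ℝ) := by
        rw [← Real.rpow_add' ha0 (by norm_num)]; norm_num
    _ ≤ (A * T ^ (-(1/3) : ℝ)) ^ (7/8 : ℝ) * (A * (T * |θ|)) ^ (1/8 : ℝ) := by gcongr
    _ = (A ^ (7/8 : ℝ) * A ^ (1/8 : ℝ)) * ((T ^ (-(1/3) : ℝ)) ^ (7/8 : ℝ) * T ^ (1/8 : ℝ)) * |θ| ^ (1/8 : ℝ) := by
        rw [Real.mul_rpow hA0 (by positivity), Real.mul_rpow hA0 (by positivity), Real.mul_rpow hT0.le (by positivity)]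
        ring
    _ = _ := by
        rw [← Real.rpow_add' hA0 (by norm_num), ← Real.rpow_mul hT0.le, ← Real.rpow_add hT0]
        norm_num

lemma err_all (r : ℕ) : ∃ A B : ℝ, 0 ≤ A ∧ 0 ≤ B ∧ ∀ n : ℕ, 16 ≤ n → ∀ θ : ℝ, |θ| ≤ π →
    ‖chi n (Zt θ) - nuhat r (Real.log (Real.log n)) θ‖ ≤
      A * (Real.log n) ^ (-(1/6) : ℝ) * |θ| ^ (1/8 : ℝ) +
      B * (|θ| ^ (r + 1) * Real.exp (-(2 / π ^ 2 * Real.log (Real.log n)) * θ ^ 2)) := by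
  obtain ⟨A, hA, h1⟩ := err_first
  obtain ⟨B, hB, h2⟩ := mm_taylor r
  refine ⟨A, B, hA, hB, ?_⟩
  intro n hn θ hθ
  have e : chi n (Zt θ) - nuhat r (Real.log (Real.log n)) θ =
    (chi n (Zt θ) - mm (Zt θ) * Complex.exp ((Real.log (Real.log n) : ℝ) * (Zt θ - 1))) +
    (mm (Zt θ) - Pr r (Zt θ - 1)) * Complex.exp ((Real.log (Real.log n) : ℝ) * (Zt θ - 1)) := by
    rw [nuhat]; ring
  rw [e]
  refine (norm_add_le _ _).trans (add_le_add (h1 n hn θ) ?_)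
  rw [norm_mul, norm_exp_Zt, ← mul_assoc]
  obtain ⟨g1, g2, g3⟩ := logn_facts n hn
  refine mul_le_mul (h2 θ) (Real.exp_le_exp.2 ?_) (by positivity) (by positivity)
  have := Real.cos_le_one_sub_mul_cos_sq hθ
  nlinarith

/-- character `e^{i k θ}` -/
def ee (k : ℤ) (θ : ℝ) : ℂ := Complex.exp (Complex.I * k * θ)

lemma continuous_ee (k : ℤ) : Continuous (ee k) := by unfold ee; fun_prop

lemma ee_add (k m : ℤ) (θ : ℝ) : ee (k + m) θ = ee k θ * ee m θ := by
  rw [ee, ee, ee, ← Complex.exp_add]; congr 1; push_cast; ring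

lemma ee_norm (k : ℤ) (θ : ℝ) : ‖ee k θ‖ = 1 := by
  have := exp_I_facts (k * θ)
  rw [ee, ← this]; congr 2; push_cast; ring

lemma Zt_pow_ee (k : ℕ) (θ : ℝ) : Zt θ ^ k = ee k θ := by
  rw [Zt, ee, ← Complex.exp_nat_mul]; congr 1; push_cast; ring

lemma ee_zero (θ : ℝ) : ee 0 θ = 1 := by simp [ee]

lemma ee_integral (k : ℤ) : ∫ θ in (-π)..π, ee k θ = if k = 0 then 2 * (π:ℂ) else 0 := by
  split_ifs with h
  · subst h
    simp only [ee_zero]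
    rw [intervalIntegral.integral_const]
    simp; ring
  · have hk : Complex.I * (k:ℂ) ≠ 0 := mul_ne_zero Complex.I_ne_zero (by exact_mod_cast h)
    unfold ee
    rw [integral_exp_mul_complex hk, div_eq_zero_iff]
    left
    rw [sub_eq_zero, Complex.exp_eq_exp_iff_exists_int]
    refine ⟨k, ?_⟩
    push_cast; ring

def fc (F : ℝ → ℂ) (m : ℤ) : ℂ := (1 / (2 * (π:ℂ))) * ∫ θ in (-π)..π, F θ * ee (-m) θ

lemma fc_ee (k m : ℤ) : fc (ee k) m = if k = m then 1 else 0 := by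
  have hpi : (π:ℂ) ≠ 0 := by exact_mod_cast Real.pi_ne_zero
  rw [fc]
  simp_rw [← ee_add]
  rw [ee_integral]
  by_cases h : k = m
  · rw [if_pos h, if_pos (by omega)]; field_simp
  · rw [if_neg h, if_neg (by omega)]; simp

lemma fc_int {F : ℝ → ℂ} (hF : Continuous F) (m : ℤ) (a b : ℝ) : 
    IntervalIntegrable (fun θ => F θ * ee (-m) θ) MeasureTheory.volume a b :=
  (hF.mul (continuous_ee _)).intervalIntegrable _ _

lemma fc_sum {ι : Type} (s : Finset ι) (F : ι → ℝ → ℂ) (hF : ∀ i, Continuous (F i)) (m : ℤ) :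
    fc (fun θ => ∑ i ∈ s, F i θ) m = ∑ i ∈ s, fc (F i) m := by
  simp only [fc, Finset.sum_mul]
  rw [intervalIntegral.integral_finsetSum (fun i _ => fc_int (hF i) m _ _), Finset.mul_sum]

lemma fc_const_mul (c : ℂ) (F : ℝ → ℂ) (m : ℤ) : fc (fun θ => c * F θ) m = c * fc F m := by
  simp only [fc, mul_assoc]
  rw [intervalIntegral.integral_const_mul]; ring

lemma fc_sub (F G : ℝ → ℂ) (hF : Continuous F) (hG : Continuous G) (m : ℤ) :
    fc (fun θ => F θ - G θ) m = fc F m - fc G m := by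
  simp only [fc, sub_mul]
  rw [intervalIntegral.integral_sub (fc_int hF m _ _) (fc_int hG m _ _), mul_sub]

lemma fc_shift (F : ℝ → ℂ) (k m : ℤ) : fc (fun θ => ee k θ * F θ) m = fc F (m - k) := by
  simp only [fc]
  congr 1
  refine intervalIntegral.integral_congr fun θ _ => ?_
  rw [show -(m - k) = k + -m by ring, ee_add]; ring

lemma continuous_chi (n : ℕ) : Continuous (fun θ => chi n (Zt θ)) := by
  unfold chi
  have := continuous_Zt
  fun_prop

lemma fc_chi (n : ℕ) (j : ℕ) : fc (fun θ => chi n (Zt θ)) j =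
    ((((Finset.Icc 1 n).filter fun k => bigOmega k = j).card : ℝ) / n : ℝ) := by
  have e : (fun θ => chi n (Zt θ)) = fun θ => (1 / (n:ℂ)) * ∑ k ∈ Finset.Icc 1 n, ee (bigOmega k) θ := by
    funext θ
    rw [chi, div_eq_mul_inv, mul_comm, one_div]
    simp_rw [Zt_pow_ee]
  rw [e, fc_const_mul, fc_sum _ _ (fun k => continuous_ee _)]
  simp_rw [fc_ee]
  rw [Finset.card_filter]
  push_cast
  rw [one_div, mul_comm, div_eq_mul_inv]
  congr 1
  refine Finset.sum_congr rfl fun k _ => ?_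
  by_cases h : bigOmega k = j <;> simp [h]

lemma fc_pois (lam : ℝ) (m : ℤ) : fc (fun θ => Complex.exp (lam * (Zt θ - 1))) m = (poissonPmf lam m : ℂ) := by
  have hs : HasSum (fun k : ℕ => ∫ θ in (-π)..π, (Real.exp (-lam) * lam ^ k / k.factorial : ℝ) * (ee k θ * ee (-m) θ))
      (∫ θ in (-π)..π, Complex.exp (lam * (Zt θ - 1)) * ee (-m) θ) := by
    have hsum : Summable (fun k : ℕ => ‖(Real.exp (-lam) * lam ^ k / k.factorial : ℝ)‖) := by
      have := (Real.summable_pow_div_factorial lam).norm.mul_left (Real.exp (-lam))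
      refine this.congr fun k => ?_
      rw [mul_div_assoc, norm_mul, Real.norm_of_nonneg (Real.exp_pos _).le]
    refine intervalIntegral.hasSum_integral_of_dominated_convergence (fun k _ => ‖(Real.exp (-lam) * lam ^ k / k.factorial : ℝ)‖) ?_ ?_ ?_ ?_ ?_
    · intro k
      exact (continuous_const.mul ((continuous_ee _).mul (continuous_ee _))).aestronglyMeasurable
    · intro k
      refine Filter.Eventually.of_forall fun θ _ => ?_
      rw [norm_mul, norm_mul, ee_norm, ee_norm, Complex.norm_real]; simp
    · exact Filter.Eventually.of_forall fun θ _ => hsum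
    · exact intervalIntegrable_const
    · refine Filter.Eventually.of_forall fun θ _ => ?_
      have h1 := NormedSpace.expSeries_div_hasSum_exp (lam * Zt θ : ℂ)
      rw [← Complex.exp_eq_exp_ℂ] at h1
      have h2 := (h1.mul_left (Complex.exp (-lam))).mul_right (ee (-m) θ)
      rw [← Complex.exp_add] at h2
      have e1 : Complex.exp (lam * (Zt θ - 1)) = Complex.exp (-lam + lam * Zt θ) := by
        congr 1; ring
      rw [e1]
      have e2 : (fun k : ℕ => ((Real.exp (-lam) * lam ^ k / k.factorial : ℝ) : ℂ) * (ee k θ * ee (-m) θ)) =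
          fun k : ℕ => Complex.exp (-lam) * ((lam * Zt θ) ^ k / k.factorial) * ee (-m) θ := by
        funext k
        push_cast
        rw [mul_pow, Zt_pow_ee]; ring
      rw [e2]
      exact h2
  have hpi : (π:ℂ) ≠ 0 := by exact_mod_cast Real.pi_ne_zero
  have hi : ∀ k : ℕ, ∫ θ in (-π)..π, ((Real.exp (-lam) * lam ^ k / k.factorial : ℝ) : ℂ) * (ee k θ * ee (-m) θ) =
      if (k : ℤ) = m then ((Real.exp (-lam) * lam ^ k / k.factorial : ℝ) : ℂ) * (2 * π) else 0 := by
    intro k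
    rw [intervalIntegral.integral_const_mul]
    simp_rw [← ee_add]
    rw [ee_integral]
    by_cases h : (k:ℤ) = m
    · rw [if_pos h, if_pos (by omega)]
    · rw [if_neg h, if_neg (by omega)]; simp
  rw [fc, ← hs.tsum_eq]
  simp_rw [hi]
  rw [poissonPmf]
  split_ifs with h
  · rw [tsum_eq_single m.toNat]
    · rw [if_pos (by omega)]; field_simp
    · intro k hk
      rw [if_neg (by omega)]
  · have : ∀ k : ℕ, ¬ ((k:ℤ) = m) := fun k => by omega
    simp [this]

lemma pois_shift {lam : ℝ} (hl : 0 < lam) (j k : ℕ) : poissonPmf lam ((j:ℤ) - k) =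
    poissonPmf lam j * (j.choose k * k.factorial * lam ^ (-(k:ℤ))) := by
  by_cases h : k ≤ j
  · rw [poissonPmf, poissonPmf, if_pos (by omega), if_pos (by omega)]
    obtain ⟨i, rfl⟩ := Nat.exists_eq_add_of_le' h
    rw [show (((i + k : ℕ) : ℤ) - k).toNat = i by omega, show (((i + k : ℕ) : ℤ)).toNat = i + k by omega]
    have h1 : ((i + k).choose k : ℝ) * k.factorial * i.factorial = (i + k).factorial := by
      have := Nat.add_choose_mul_factorial_mul_factorial i k
      rw [← this]; push_cast; ring
    rw [← h1, zpow_neg, zpow_natCast, pow_add]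
    have : ((i + k).choose k : ℝ) ≠ 0 := by exact_mod_cast (Nat.choose_pos (by omega)).ne'
    have : (k.factorial : ℝ) ≠ 0 := by exact_mod_cast k.factorial_ne_zero
    have : (i.factorial : ℝ) ≠ 0 := by exact_mod_cast i.factorial_ne_zero
    field_simp
  · rw [poissonPmf, if_neg (by omega), Nat.choose_eq_zero_of_lt (by omega)]; simp

lemma fc_nu_term {lam : ℝ} (hl : 0 < lam) (l j : ℕ) :
    fc (fun θ => Complex.exp (lam * (Zt θ - 1)) * (Zt θ - 1) ^ l) j =
      ((poissonPmf lam j * ((-1) ^ l * charlier l lam j) : ℝ) : ℂ) := by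
  have hc : Continuous (fun θ => Complex.exp (lam * (Zt θ - 1))) := by
    have := continuous_Zt
    fun_prop
  have e : (fun θ => Complex.exp (lam * (Zt θ - 1)) * (Zt θ - 1) ^ l) = fun θ =>
      ∑ k ∈ Finset.range (l + 1), ((-1) ^ (l - k) * l.choose k : ℂ) * (ee k θ * Complex.exp (lam * (Zt θ - 1))) := by
    funext θ
    rw [sub_eq_add_neg (Zt θ) 1, add_pow, Finset.mul_sum]
    refine Finset.sum_congr rfl fun k _ => ?_
    rw [Zt_pow_ee]; ring
  rw [e, fc_sum _ (fun k θ => ((-1) ^ (l - k) * l.choose k : ℂ) * (ee k θ * Complex.exp (lam * (Zt θ - 1)))) (fun k => continuous_const.mul ((continuous_ee _).mul hc))]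
  rw [charlier, Finset.mul_sum, Finset.mul_sum, Complex.ofReal_sum]
  refine Finset.sum_congr rfl fun k hk => ?_
  rw [fc_const_mul, fc_shift, fc_pois, pois_shift hl]
  have hkl : k ≤ l := by simpa [Nat.lt_succ_iff] using hk
  have h1 : ((-1:ℂ)) ^ (l - k) = (-1) ^ l * (-1) ^ k := by
    obtain ⟨i, rfl⟩ := Nat.exists_eq_add_of_le' hkl
    rw [Nat.add_sub_cancel, pow_add, mul_assoc, ← mul_pow]; simp
  rw [h1]
  push_cast
  ring

lemma continuous_nuhat (r : ℕ) (lam : ℝ) : Continuous (nuhat r lam) := by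
  unfold nuhat Pr
  have := continuous_Zt
  fun_prop

lemma fc_nuhat {lam : ℝ} (hl : 0 < lam) (r j : ℕ) :
    (fc (nuhat r lam) j).re = pcMeasure lam r (fun i => (taylorCoeff Phi2 i).re) (j : ℤ) := by
  have e : nuhat r lam = fun θ => ∑ l ∈ Finset.range (r + 1), taylorCoeff Phi2 l * (Complex.exp (lam * (Zt θ - 1)) * (Zt θ - 1) ^ l) := by
    funext θ
    rw [nuhat, Pr, Finset.mul_sum]
    exact Finset.sum_congr rfl fun l _ => by ring
  have := continuous_Zt
  rw [e, fc_sum _ _ (fun l => by fun_prop)]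
  simp_rw [fc_const_mul, fc_nu_term hl]
  rw [Complex.re_sum]
  simp_rw [Complex.re_mul_ofReal]
  rw [Finset.sum_range_eq_add_Ico _ (by omega), taylorCoeff_zero, pcMeasure, mul_add]
  congr 1
  · simp [charlier]
  · rw [Finset.mul_sum]
    refine Finset.sum_congr ?_ fun l _ => ?_
    · ext; simp
    · rw [Int.toNat_natCast]; ring

open MeasureTheory in
lemma gauss_mom {q : ℝ} (hq : -1 < q) : ∃ K : ℝ, 0 ≤ K ∧ ∀ b : ℝ, 0 < b →
    Integrable (fun θ : ℝ => |θ| ^ q * Real.exp (-b * θ ^ 2)) ∧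
    ∫ θ : ℝ, |θ| ^ q * Real.exp (-b * θ ^ 2) = K * b ^ (-(q + 1) / 2) := by
  have hG : 0 < Real.Gamma ((q + 1) / 2) := Real.Gamma_pos_of_pos (by linarith)
  refine ⟨Real.Gamma ((q + 1) / 2), hG.le, ?_⟩
  intro b hb
  have h1 := integral_comp_abs (f := fun x => x ^ q * Real.exp (-b * x ^ (2:ℝ)))
  rw [integral_rpow_mul_exp_neg_mul_rpow two_pos hq hb] at h1
  have h2 : ∫ θ : ℝ, |θ| ^ q * Real.exp (-b * θ ^ 2) = Real.Gamma ((q + 1) / 2) * b ^ (-(q + 1) / 2) := by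
    have e : ∀ θ : ℝ, |θ| ^ (2:ℝ) = θ ^ 2 := by intro θ; simp
    simp_rw [e] at h1
    rw [h1]; ring
  refine ⟨?_, h2⟩
  by_contra hc
  rw [integral_undef hc] at h2
  have : 0 < Real.Gamma ((q + 1) / 2) * b ^ (-(q + 1) / 2) := by positivity
  linarith

open MeasureTheory in
lemma int_bound {p q : ℝ} (hp : -1 < p) (hq : -1 < q) : ∃ K : ℝ, 0 ≤ K ∧ ∀ (H : ℝ → ℂ) (A B b : ℝ), 0 ≤ A → 0 ≤ B → 0 < b →
    (∀ θ : ℝ, θ ≠ 0 → |θ| ≤ π → ‖H θ‖ ≤ A * |θ| ^ p + B * (|θ| ^ q * Real.exp (-b * θ ^ 2))) →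
    ‖∫ θ in (-π)..π, H θ‖ ≤ K * (A + B * b ^ (-(q + 1) / 2)) := by
  obtain ⟨K1, hK1, h1⟩ := gauss_mom hp
  obtain ⟨K2, hK2, h2⟩ := gauss_mom hq
  refine ⟨Real.exp (π ^ 2) * K1 + K2, by positivity, ?_⟩
  intro H A B b hA hB hb hH
  obtain ⟨i1, e1⟩ := h1 1 one_pos
  obtain ⟨i2, e2⟩ := h2 b hb
  have hpi : -π ≤ π := by linarith [Real.pi_pos]
  set g : ℝ → ℝ := fun θ => (A * Real.exp (π ^ 2)) * (|θ| ^ p * Real.exp (-1 * θ ^ 2)) + B * (|θ| ^ q * Real.exp (-b * θ ^ 2)) with hg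
  have ig : Integrable g := (i1.const_mul _).add (i2.const_mul _)
  have hg0 : ∀ θ, 0 ≤ g θ := fun θ => by rw [hg]; positivity
  have eg : ∫ θ, g θ = A * Real.exp (π ^ 2) * K1 + B * (K2 * b ^ (-(q + 1) / 2)) := by
    rw [hg, integral_add (i1.const_mul _) (i2.const_mul _), integral_const_mul, integral_const_mul, e1, e2]
    simp
  rw [intervalIntegral.integral_of_le hpi]
  have hne : ∀ᵐ θ : ℝ ∂(volume.restrict (Set.Ioc (-π) π)), θ ≠ 0 := by
    refine ae_restrict_of_ae ?_
    rw [ae_iff]; simp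
  calc _ ≤ ∫ θ in Set.Ioc (-π) π, g θ := by
        refine norm_integral_le_of_norm_le ig.integrableOn ?_
        filter_upwards [ae_restrict_mem measurableSet_Ioc, hne] with θ hθ hθ0
        have hab : |θ| ≤ π := abs_le.2 ⟨hθ.1.le, hθ.2⟩
        refine (hH θ hθ0 hab).trans ?_
        rw [hg]
        simp only
        gcongr ?_ + _
        rw [mul_assoc]
        gcongr
        rw [mul_left_comm, ← Real.exp_add]
        refine le_mul_of_one_le_right (by positivity) (Real.one_le_exp ?_)
        have : θ ^ 2 ≤ π ^ 2 := by rw [← sq_abs]; gcongr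
        linarith
    _ ≤ ∫ θ, g θ := setIntegral_le_integral ig (Filter.Eventually.of_forall hg0)
    _ ≤ _ := by
        rw [eg]
        have : 0 ≤ A * K2 := by positivity
        have : 0 ≤ Real.exp (π ^ 2) * K1 * (B * b ^ (-(q + 1) / 2)) := by positivity
        nlinarith

lemma exp_decay (s : ℝ) : ∃ K : ℝ, 0 ≤ K ∧ ∀ n : ℕ, 16 ≤ n →
    (Real.log n) ^ (-(1/6) : ℝ) ≤ K * Real.log (Real.log n) ^ (-s) := by
  set k := ⌈s⌉₊ with hk
  refine ⟨6 ^ k * k.factorial, by positivity, ?_⟩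
  intro n hn
  obtain ⟨h1, h2, h3⟩ := logn_facts n hn
  set T := Real.log n with hT
  set lam := Real.log T with hlam
  have hT0 : 0 < T := by linarith
  have hl0 : 0 < lam := by linarith
  have e1 : T ^ (-(1/6) : ℝ) = Real.exp (-(lam / 6)) := by
    rw [Real.rpow_def_of_pos hT0]; congr 1; rw [← hlam]; ring
  have h4 := Real.pow_div_factorial_le_exp (lam / 6) (by positivity) k
  have h5 : lam ^ s ≤ lam ^ k := by
    rw [← Real.rpow_natCast]
    exact Real.rpow_le_rpow_of_exponent_le h2 (Nat.le_ceil s)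
  have h6 : lam ^ s ≤ 6 ^ k * k.factorial * Real.exp (lam / 6) := by
    refine h5.trans ?_
    rw [div_pow, div_div, div_le_iff₀ (by positivity)] at h4
    linarith
  rw [e1, Real.exp_neg, Real.rpow_neg hl0.le, ← div_eq_mul_inv, le_div_iff₀ (by positivity), inv_mul_le_iff₀ (by positivity)]
  linarith

lemma final_int (r : ℕ) (e : ℝ) (he0 : 0 ≤ e) (he1 : e ≤ 1) : ∃ K : ℝ, 0 ≤ K ∧ ∀ n : ℕ, 16 ≤ n → ∀ D : ℝ → ℂ,
    (∀ θ : ℝ, θ ≠ 0 → |θ| ≤ π → ‖D θ‖ ≤ π * |θ| ^ (-e)) →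
    ‖∫ θ in (-π)..π, (chi n (Zt θ) - nuhat r (Real.log (Real.log n)) θ) * D θ‖ ≤
      K * Real.log (Real.log n) ^ (-((r:ℝ) + 2 - e) / 2) := by
  obtain ⟨A, B, hA, hB, h⟩ := err_all r
  have hr0 : (0:ℝ) ≤ r := by positivity
  obtain ⟨K, hK, hI⟩ := int_bound (p := 1/8 - e) (q := (r:ℝ) + 1 - e) (by linarith) (by linarith)
  obtain ⟨K2, hK2, hE⟩ := exp_decay (((r:ℝ) + 2 - e) / 2)
  set c : ℝ := 2 / π ^ 2 with hc
  have hpi := Real.pi_pos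
  have hc0 : 0 < c := by positivity
  refine ⟨K * (π * A * K2 + π * B * c ^ (-((r:ℝ) + 2 - e) / 2)), by positivity, ?_⟩
  intro n hn D hD
  obtain ⟨h1, h2, h3⟩ := logn_facts n hn
  set T := Real.log n with hT
  set lam := Real.log T with hlam
  have hT0 : 0 < T := by linarith
  have hl0 : 0 < lam := by linarith
  refine (hI _ (π * A * T ^ (-(1/6) : ℝ)) (π * B) (c * lam) (by positivity) (by positivity) (by positivity) ?_).trans ?_
  · intro θ h0 hθ
    have ha : 0 < |θ| := abs_pos.2 h0
    rw [norm_mul]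
    calc _ ≤ (A * T ^ (-(1/6) : ℝ) * |θ| ^ (1/8 : ℝ) + B * (|θ| ^ (r + 1) * Real.exp (-(c * lam) * θ ^ 2))) * (π * |θ| ^ (-e)) :=
          mul_le_mul (h n hn θ hθ) (hD θ h0 hθ) (norm_nonneg _) (by positivity)
      _ = _ := by
          rw [sub_eq_add_neg, Real.rpow_add ha, sub_eq_add_neg ((r:ℝ) + 1), Real.rpow_add ha]
          have : |θ| ^ ((r:ℝ) + 1) = |θ| ^ (r + 1) := by rw [← Real.rpow_natCast]; push_cast; rfl
          rw [this]
          ring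
  · rw [mul_assoc K]
    gcongr
    have h4 := hE n hn
    rw [show -((r:ℝ) + 1 - e + 1) / 2 = -((r:ℝ) + 2 - e) / 2 by ring, Real.mul_rpow hc0.le hl0.le]
    rw [← neg_div 2 ((r:ℝ) + 2 - e)] at h4
    have h5 : π * A * T ^ (-(1/6) : ℝ) ≤ π * A * (K2 * lam ^ (-((r:ℝ) + 2 - e) / 2)) := by gcongr
    linarith

lemma kernel_bound (l : ℕ) {θ : ℝ} (h0 : θ ≠ 0) (hθ : |θ| ≤ π) :
    ‖∑ j ∈ Finset.range (l + 1), ee (-(j:ℤ)) θ‖ ≤ π * |θ| ^ (-1 : ℝ) := by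
  have ha : 0 < |θ| := abs_pos.2 h0
  have hpi := Real.pi_pos
  have e1 : ∀ j : ℕ, ee (-(j:ℤ)) θ = Zt (-θ) ^ j := by
    intro j
    rw [Zt_pow_ee, ee, ee]; congr 1; push_cast; ring
  simp_rw [e1]
  have h1 : 2 / π * |θ| ≤ ‖Zt (-θ) - 1‖ := by
    rw [Zt, Complex.norm_exp_I_mul_ofReal_sub_one, norm_mul]
    have := Real.mul_abs_le_abs_sin (x := -θ / 2) (by rw [abs_div, abs_neg]; norm_num; linarith)
    rw [abs_div, abs_neg, abs_two] at this
    rw [Real.norm_eq_abs, Real.norm_eq_abs, abs_two]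
    linarith
  have h2 := geom_sum_mul (Zt (-θ)) (l + 1)
  have h3 : ‖∑ j ∈ Finset.range (l + 1), Zt (-θ) ^ j‖ * ‖Zt (-θ) - 1‖ ≤ 2 := by
    rw [← norm_mul, h2]
    refine (norm_sub_le _ _).trans ?_
    rw [norm_pow, Zt_norm]; norm_num
  have h4 : ‖∑ j ∈ Finset.range (l + 1), Zt (-θ) ^ j‖ * (2 / π * |θ|) ≤ 2 :=
    (mul_le_mul_of_nonneg_left h1 (norm_nonneg _)).trans h3
  rw [Real.rpow_neg_one, ← div_eq_mul_inv, le_div_iff₀ ha]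
  have e2 : ‖∑ j ∈ Finset.range (l + 1), Zt (-θ) ^ j‖ * |θ| = (‖∑ j ∈ Finset.range (l + 1), Zt (-θ) ^ j‖ * (2 / π * |θ|)) * (π / 2) := by
    field_simp
  rw [e2]
  calc _ ≤ 2 * (π / 2) := by gcongr
    _ = π := by ring

lemma card_le_eq_sum (n l : ℕ) : (((Finset.Icc 1 n).filter fun k => bigOmega k ≤ l).card : ℝ) / n =
    ∑ j ∈ Finset.range (l + 1), (((Finset.Icc 1 n).filter fun k => bigOmega k = j).card : ℝ) / n := by
  rw [← Finset.sum_div]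
  congr 1
  rw [← Nat.cast_sum]
  congr 1
  rw [Finset.card_eq_sum_card_fiberwise (f := bigOmega) (t := Finset.range (l + 1))]
  · refine Finset.sum_congr rfl fun j hj => ?_
    congr 1
    ext k
    simp only [Finset.mem_filter, Finset.mem_range] at hj ⊢
    constructor
    · rintro ⟨⟨h1, _⟩, h3⟩; exact ⟨h1, h3⟩
    · rintro ⟨h1, h3⟩; exact ⟨⟨h1, by omega⟩, h3⟩
  · intro k hk
    simp only [Finset.coe_filter, Set.mem_ofPred_eq] at hk
    simp; omega

lemma main_aux (r : ℕ) : ∃ C : ℝ, ∀ n : ℕ, 16 ≤ n →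
    (∀ j : ℕ, |(((Finset.Icc 1 n).filter fun k => bigOmega k = j).card : ℝ) / n -
        pcMeasure (Real.log (Real.log n)) r (fun i => (taylorCoeff Phi2 i).re) (j : ℤ)| ≤
      C * Real.log (Real.log n) ^ (-1 - (r : ℝ) / 2)) ∧
    (∀ l : ℕ, |(((Finset.Icc 1 n).filter fun k => bigOmega k ≤ l).card : ℝ) / n -
        ∑ j ∈ Finset.range (l + 1),
          pcMeasure (Real.log (Real.log n)) r (fun i => (taylorCoeff Phi2 i).re) (j : ℤ)| ≤
      C * Real.log (Real.log n) ^ (-((r : ℝ) + 1) / 2)) := by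
  obtain ⟨K0, hK0, h0⟩ := final_int r 0 le_rfl zero_le_one
  obtain ⟨K1, hK1, h1⟩ := final_int r 1 zero_le_one le_rfl
  have hpi := Real.pi_gt_three
  refine ⟨K0 + K1, ?_⟩
  intro n hn
  obtain ⟨g1, g2, g3⟩ := logn_facts n hn
  set lam := Real.log (Real.log n) with hlam
  have hl0 : 0 < lam := by linarith
  have hcont : Continuous (fun θ => chi n (Zt θ) - nuhat r lam θ) := (continuous_chi n).sub (continuous_nuhat r lam)
  have hdiff : ∀ j : ℕ, (((Finset.Icc 1 n).filter fun k => bigOmega k = j).card : ℝ) / n -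
        pcMeasure lam r (fun i => (taylorCoeff Phi2 i).re) (j : ℤ) =
        (fc (fun θ => chi n (Zt θ) - nuhat r lam θ) j).re := by
    intro j
    rw [fc_sub _ _ (continuous_chi n) (continuous_nuhat r lam), Complex.sub_re, fc_nuhat hl0, fc_chi, Complex.ofReal_re]
  have hpre : ∀ (I : ℂ) (x : ℝ), ‖I‖ ≤ x → |((1 / (2 * (π:ℂ))) * I).re| ≤ x := by
    intro I x hx
    refine (Complex.abs_re_le_norm _).trans ?_
    have : ‖(1 / (2 * (π:ℂ)))‖ ≤ 1 := by
      rw [norm_div, norm_mul, Complex.norm_real, Real.norm_of_nonneg (by linarith)]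
      simp only [norm_one, Complex.norm_ofNat]
      rw [div_le_one (by linarith)]; linarith
    rw [norm_mul]
    nlinarith [norm_nonneg I]
  constructor
  · intro j
    rw [hdiff, fc]
    refine hpre _ _ ((h0 n hn _ ?_).trans ?_)
    · intro θ _ _
      rw [ee_norm, neg_zero, Real.rpow_zero]; linarith
    · rw [← hlam, show -((r:ℝ) + 2 - 0) / 2 = -1 - (r:ℝ) / 2 by ring]
      gcongr; linarith
  · intro l
    have e : (((Finset.Icc 1 n).filter fun k => bigOmega k ≤ l).card : ℝ) / n -
        ∑ j ∈ Finset.range (l + 1), pcMeasure lam r (fun i => (taylorCoeff Phi2 i).re) (j : ℤ) =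
        ((1 / (2 * (π:ℂ))) * ∫ θ in (-π)..π, (chi n (Zt θ) - nuhat r lam θ) * ∑ j ∈ Finset.range (l + 1), ee (-(j:ℤ)) θ).re := by
      rw [card_le_eq_sum, ← Finset.sum_sub_distrib]
      simp_rw [hdiff]
      rw [← Complex.re_sum]
      congr 1
      simp only [fc, Finset.mul_sum]
      rw [intervalIntegral.integral_finsetSum (fun (i : ℕ) _ => fc_int hcont (i : ℤ) _ _), Finset.mul_sum]
    rw [e]
    refine hpre _ _ ((h1 n hn _ fun θ hθ0 hθ => kernel_bound l hθ0 hθ).trans ?_)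
    rw [← hlam, show -((r:ℝ) + 2 - 1) / 2 = -((r:ℝ) + 1) / 2 by ring]
    gcongr; linarith

/-- Theorem 6.2 for `Ω` (a refinement of the Erdős–Kac theorem): with
`λ_n = log log n` and `ν_r^{(2)}` the Poisson–Charlier signed measure built from the
Taylor coefficients `ã_l` of `Φ₂` at `0`, both the point probabilities and the
distribution function of `Ω(N_n)`, for `N_n` uniform on `{1,…,n}`, are approximated
with errors `O((log log n)^{-1-r/2}) + ã₁O(1/log n)` and
`O((log log n)^{-(r+1)/2}) + O(log log n/log n)` respectively. -/
theorem erdos_kac_refinement_bigOmega (r : ℕ) (hr : 1 ≤ r) :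
    ∃ C Ct : ℝ,
      ∀ n : ℕ, 16 ≤ n →
        (∀ j : ℕ,
          |(((Finset.Icc 1 n).filter fun k => bigOmega k = j).card : ℝ) / n -
              pcMeasure (Real.log (Real.log n)) r
                (fun i => (taylorCoeff Phi2 i).re) (j : ℤ)| ≤
            C * Real.log (Real.log n) ^ (-1 - (r : ℝ) / 2) +
              (taylorCoeff Phi2 1).re * Ct / Real.log n) ∧
        (∀ l : ℕ,
          |(((Finset.Icc 1 n).filter fun k => bigOmega k ≤ l).card : ℝ) / n -
              ∑ j ∈ Finset.range (l + 1),
                pcMeasure (Real.log (Real.log n)) r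
                  (fun i => (taylorCoeff Phi2 i).re) (j : ℤ)| ≤
            C * Real.log (Real.log n) ^ (-((r : ℝ) + 1) / 2) +
              Ct * Real.log (Real.log n) / Real.log n) := by
  obtain ⟨C, hC⟩ := main_aux r
  refine ⟨C, 0, fun n hn => ⟨fun j => ?_, fun l => ?_⟩⟩
  · rw [mul_zero, zero_div, add_zero]
    exact (hC n hn).1 j
  · rw [zero_mul, zero_div, add_zero]
    exact (hC n hn).2 l

end
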